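/- The Foulkes–Howe map α restricts to a ℂ-linear isomorphism in degree b: the map from the space of homogeneous polynomials of degree b in S to the space of homogeneous polynomials of degree ab in R given by P ↦ α(P) is bijective. (This is the key case (1.8), an isomorphism Sym^b(Sym^{ab}ℂ²) ≅ Sym^{ab}(Sym^b ℂ²) realizing Hermite reciprocity.) -/

import Mathlib

open MvPolynomial

/-- The generic binary form `G = ∑_{i=0}^{b} u_i x^i y^{b-i}` of degree `b`,
viewed as a polynomial in two variables `x = X 0`, `y = X 1` with coefficients in
`R = MvPolynomial (Fin (b+1)) ℂ`. -/
noncomputable def genForm (b : ℕ) : MvPolynomial (Fin 2) (MvPolynomial (Fin (b + 1)) ℂ) :=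
  ∑ i : Fin (b + 1),
    MvPolynomial.C (MvPolynomial.X i) *
      MvPolynomial.X (0 : Fin 2) ^ (i : ℕ) * MvPolynomial.X (1 : Fin 2) ^ (b - (i : ℕ))

/-- The coefficient `c_j ∈ R` of `x^j y^{ab-j}` in `G^a`. -/
noncomputable def coeffC (a b j : ℕ) : MvPolynomial (Fin (b + 1)) ℂ :=
  MvPolynomial.coeff
    (Finsupp.single (0 : Fin 2) j + Finsupp.single (1 : Fin 2) (a * b - j))
    (genForm b ^ a)

/-- The Foulkes–Howe homomorphism `α : S → R`, `z_j ↦ c_j`. -/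
noncomputable def FH (a b : ℕ) :
    MvPolynomial (Fin (a * b + 1)) ℂ →ₐ[ℂ] MvPolynomial (Fin (b + 1)) ℂ :=
  MvPolynomial.aeval fun j : Fin (a * b + 1) => coeffC a b (j : ℕ)

section Dunkl

variable {ι : Type*} [DecidableEq ι]

theorem X_sub_X_dvd_sub_rename_swap (i j : ι) (p : MvPolynomial ι ℂ) :
    (X i - X j : MvPolynomial ι ℂ) ∣ p - rename (Equiv.swap i j) p := by
  induction p using MvPolynomial.induction_on with
  | C r => simp
  | add p q hp hq =>
    rw [map_add, add_sub_add_comm]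
    exact dvd_add hp hq
  | mul_X p k hp =>
    have h : (X i - X j : MvPolynomial ι ℂ) ∣ X k - X (Equiv.swap i j k) := by
      rcases eq_or_ne k i with rfl | hi
      · simp
      rcases eq_or_ne k j with rfl | hj
      · rw [Equiv.swap_apply_right, ← neg_sub]
        exact neg_dvd.2 dvd_rfl
      · simp [Equiv.swap_apply_of_ne_of_ne hi hj]
    have e : p * X k - rename (Equiv.swap i j) (p * X k) =
        (p - rename (Equiv.swap i j) p) * X k +
          rename (Equiv.swap i j) p * (X k - X (Equiv.swap i j k)) := by
      rw [map_mul, rename_X]; ring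
    rw [e]
    exact dvd_add (hp.mul_right _) (h.mul_left _)

theorem X_sub_X_ne_zero {i j : ι} (h : i ≠ j) : (X i - X j : MvPolynomial ι ℂ) ≠ 0 :=
  sub_ne_zero.2 fun e => h (X_injective e)

theorem exists_divDiff (i j : ι) : ∃ L : MvPolynomial ι ℂ →ₗ[ℂ] MvPolynomial ι ℂ,
    (∀ p, (X i - X j) * L p = p - rename (Equiv.swap i j) p) ∧ (i = j → L = 0) := by
  by_cases h : i = j
  · exact ⟨0, fun p => by simp [h], fun _ => rfl⟩
  · choose f hf using X_sub_X_dvd_sub_rename_swap i j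
    refine ⟨⟨⟨f, fun p q => ?_⟩, fun r p => ?_⟩, fun p => (hf p).symm, fun e => absurd e h⟩
    · apply mul_left_cancel₀ (X_sub_X_ne_zero h)
      rw [mul_add, ← hf, ← hf, ← hf, map_add]; ring
    · apply mul_left_cancel₀ (X_sub_X_ne_zero h)
      rw [RingHom.id_apply, mul_smul_comm, ← hf, ← hf, map_smul, smul_sub]

/-- The divided difference `(p - s_{ij} p) / (X i - X j)`, with value `0` for `i = j`. -/
noncomputable def divDiff (i j : ι) : MvPolynomial ι ℂ →ₗ[ℂ] MvPolynomial ι ℂ :=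
  (exists_divDiff i j).choose

theorem X_sub_X_mul_divDiff (i j : ι) (p : MvPolynomial ι ℂ) :
    (X i - X j) * divDiff i j p = p - rename (Equiv.swap i j) p :=
  (exists_divDiff i j).choose_spec.1 p

@[simp] theorem divDiff_self (i : ι) : divDiff i i = 0 :=
  (exists_divDiff i i).choose_spec.2 rfl

theorem divDiff_eq_of {i j : ι} (h : i ≠ j) {p q : MvPolynomial ι ℂ}
    (e : (X i - X j) * q = p - rename (Equiv.swap i j) p) : divDiff i j p = q :=
  mul_left_cancel₀ (X_sub_X_ne_zero h) ((X_sub_X_mul_divDiff i j p).trans e.symm)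

theorem divDiff_eq_zero {i j : ι} {p : MvPolynomial ι ℂ}
    (h : rename (Equiv.swap i j) p = p) : divDiff i j p = 0 := by
  by_cases e : i = j
  · simp [e]
  · exact divDiff_eq_of e (by simp [h])

theorem divDiff_mul {i j : ι} {p q : MvPolynomial ι ℂ}
    (h : rename (Equiv.swap i j) p = p) : divDiff i j (p * q) = p * divDiff i j q := by
  by_cases e : i = j
  · simp [e]
  · apply divDiff_eq_of e
    rw [map_mul, h, mul_left_comm, X_sub_X_mul_divDiff]; ring

theorem divDiff_X_mul_of_ne {i j l : ι} (hi : l ≠ i) (hj : l ≠ j) (p : MvPolynomial ι ℂ) :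
    divDiff i j (X l * p) = X l * divDiff i j p :=
  divDiff_mul (by rw [rename_X, Equiv.swap_apply_of_ne_of_ne hi hj])

theorem divDiff_X_mul_left {i j : ι} (h : i ≠ j) (p : MvPolynomial ι ℂ) :
    divDiff i j (X i * p) = X i * divDiff i j p + rename (Equiv.swap i j) p := by
  apply divDiff_eq_of h
  rw [mul_add, mul_left_comm, X_sub_X_mul_divDiff, map_mul, rename_X, Equiv.swap_apply_left]; ring

theorem divDiff_X_mul_right {i j : ι} (h : i ≠ j) (p : MvPolynomial ι ℂ) :
    divDiff i j (X j * p) = X j * divDiff i j p - rename (Equiv.swap i j) p := by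
  apply divDiff_eq_of h
  rw [mul_sub, mul_left_comm, X_sub_X_mul_divDiff, map_mul, rename_X, Equiv.swap_apply_right]; ring

theorem rename_divDiff (σ : Equiv.Perm ι) (i j : ι) (p : MvPolynomial ι ℂ) :
    rename σ (divDiff i j p) = divDiff (σ i) (σ j) (rename σ p) := by
  by_cases e : i = j
  · simp [e]
  · symm
    apply divDiff_eq_of (σ.injective.ne e)
    have := congrArg (rename σ) (X_sub_X_mul_divDiff i j p)
    simp only [map_mul, map_sub, rename_X] at this
    rw [this, rename_rename, rename_rename]
    congr 3
    ext k
    simp [Equiv.swap_apply_def, apply_ite σ]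

theorem eval_divDiff {i j : ι} (p : MvPolynomial ι ℂ) {y : ι → ℂ} (h : y i ≠ y j) :
    eval y (divDiff i j p) =
      (eval y p - eval y (rename (Equiv.swap i j) p)) / (y i - y j) := by
  rw [eq_div_iff (sub_ne_zero.2 h), ← map_sub, ← X_sub_X_mul_divDiff]
  simp [mul_comm]

theorem rename_pderiv (σ : Equiv.Perm ι) (i : ι) (p : MvPolynomial ι ℂ) :
    rename σ (pderiv i p) = pderiv (σ i) (rename σ p) :=
  (pderiv_rename σ.injective i p).symm

variable [Fintype ι]

/-- The Dunkl operator of the symmetric group with multiplicity parameter `-c`. -/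
noncomputable def dunkl (c : ℂ) (i : ι) : Module.End ℂ (MvPolynomial ι ℂ) :=
  (pderiv i).toLinearMap - c • ∑ j, divDiff i j

theorem dunkl_apply (c : ℂ) (i : ι) (p : MvPolynomial ι ℂ) :
    dunkl c i p = pderiv i p - c • ∑ j, divDiff i j p := by
  simp [dunkl]

theorem rename_dunkl (c : ℂ) (σ : Equiv.Perm ι) (i : ι) (p : MvPolynomial ι ℂ) :
    rename σ (dunkl c i p) = dunkl c (σ i) (rename σ p) := by
  simp only [dunkl_apply, map_sub, map_smul, map_sum, rename_divDiff, rename_pderiv]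
  rw [Equiv.sum_comp σ fun j => divDiff (σ i) j (rename σ p)]

theorem dunkl_C (c : ℂ) (i : ι) (r : ℂ) : dunkl c i (C r) = 0 := by
  rw [dunkl_apply, pderiv_C, Finset.sum_eq_zero, smul_zero, sub_zero]
  exact fun j _ => divDiff_eq_zero (rename_C _ _)

theorem dunkl_X_mul_of_ne (c : ℂ) {i j : ι} (h : j ≠ i) (p : MvPolynomial ι ℂ) :
    dunkl c j (X i * p) = X i * dunkl c j p + c • rename (Equiv.swap i j) p := by
  have e : ∑ l, divDiff j l (X i * p) =
      X i * ∑ l, divDiff j l p - rename (Equiv.swap i j) p := by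
    rw [← Finset.add_sum_erase _ _ (Finset.mem_univ i),
      ← Finset.add_sum_erase _ (fun l => divDiff j l p) (Finset.mem_univ i),
      divDiff_X_mul_right h, Equiv.swap_comm j i, mul_add, Finset.mul_sum,
      Finset.sum_congr rfl fun l hl => divDiff_X_mul_of_ne h.symm (Finset.ne_of_mem_erase hl).symm p]
    ring
  rw [dunkl_apply, dunkl_apply, e, Derivation.leibniz, pderiv_X_of_ne h.symm]
  simp only [smul_eq_mul, mul_zero, add_zero, smul_sub, mul_sub, mul_smul_comm]
  ring

theorem dunkl_X_mul_self (c : ℂ) (i : ι) (p : MvPolynomial ι ℂ) :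
    dunkl c i (X i * p) =
      X i * dunkl c i p + p - c • ∑ l ∈ Finset.univ.erase i, rename (Equiv.swap i l) p := by
  have e : ∑ l, divDiff i l (X i * p) =
      X i * ∑ l, divDiff i l p + ∑ l ∈ Finset.univ.erase i, rename (Equiv.swap i l) p := by
    rw [← Finset.add_sum_erase _ _ (Finset.mem_univ i),
      ← Finset.add_sum_erase _ (fun l => divDiff i l p) (Finset.mem_univ i),
      divDiff_self, LinearMap.zero_apply, LinearMap.zero_apply, zero_add, zero_add, Finset.mul_sum,
      ← Finset.sum_add_distrib]
    exact Finset.sum_congr rfl fun l hl => divDiff_X_mul_left (Finset.ne_of_mem_erase hl).symm p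
  rw [dunkl_apply, dunkl_apply, e, Derivation.leibniz, pderiv_X_self]
  simp only [smul_eq_mul, mul_one, smul_add, mul_sub, mul_smul_comm]
  ring

theorem dunkl_comm_apply (c : ℂ) (i j : ι) (p : MvPolynomial ι ℂ) :
    dunkl c i (dunkl c j p) = dunkl c j (dunkl c i p) := by
  rcases eq_or_ne i j with rfl | hij
  · rfl
  have key : ∀ (i j : ι) (hij : i ≠ j) (p : MvPolynomial ι ℂ),
      dunkl c i (dunkl c j p) = dunkl c j (dunkl c i p) →
      dunkl c i (dunkl c j (X i * p)) = dunkl c j (dunkl c i (X i * p)) := by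
    intro i j hij p hp
    have h1 : ∑ l ∈ Finset.univ.erase i, dunkl c j (rename (Equiv.swap i l) p) =
        rename (Equiv.swap i j) (dunkl c i p) +
          ∑ l ∈ (Finset.univ.erase i).erase j, rename (Equiv.swap i l) (dunkl c j p) := by
      rw [← Finset.add_sum_erase _ _ (Finset.mem_erase.2 ⟨hij.symm, Finset.mem_univ j⟩),
        rename_dunkl, Equiv.swap_apply_left]
      congr 1
      refine Finset.sum_congr rfl fun l hl => ?_
      rw [rename_dunkl, Equiv.swap_apply_of_ne_of_ne hij.symm (Finset.ne_of_mem_erase hl).symm]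
    have h2 : ∑ l ∈ Finset.univ.erase i, rename (Equiv.swap i l) (dunkl c j p) =
        rename (Equiv.swap i j) (dunkl c j p) +
          ∑ l ∈ (Finset.univ.erase i).erase j, rename (Equiv.swap i l) (dunkl c j p) := by
      rw [← Finset.add_sum_erase _ _ (Finset.mem_erase.2 ⟨hij.symm, Finset.mem_univ j⟩)]
    have h3 : dunkl c i (rename (Equiv.swap i j) p) = rename (Equiv.swap i j) (dunkl c j p) := by
      rw [rename_dunkl, Equiv.swap_apply_right]
    rw [dunkl_X_mul_of_ne c hij.symm, dunkl_X_mul_self c i p, map_add, map_sub, map_add,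
      dunkl_X_mul_self, dunkl_X_mul_of_ne c hij.symm, map_smul, map_smul, map_sum, h1, h2, h3, hp]
    simp only [smul_add]
    ring
  induction p using MvPolynomial.induction_on with
  | C r => simp [dunkl_C]
  | add p q hp hq => simp only [map_add, hp, hq]
  | mul_X p k hp =>
    rw [mul_comm]
    rcases eq_or_ne k i with rfl | hi
    · exact key k j hij p hp
    rcases eq_or_ne k j with rfl | hj
    · exact (key k i hij.symm p hp.symm).symm
    · rw [dunkl_X_mul_of_ne c hj.symm, dunkl_X_mul_of_ne c hi.symm, map_add, map_add,
        dunkl_X_mul_of_ne c hj.symm, dunkl_X_mul_of_ne c hi.symm, map_smul, map_smul,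
        rename_dunkl, rename_dunkl, Equiv.swap_apply_of_ne_of_ne hj.symm hij.symm,
        Equiv.swap_apply_of_ne_of_ne hi.symm hij, hp]
      ring

theorem dunkl_comm (c : ℂ) (i j : ι) : dunkl c i * dunkl c j = dunkl c j * dunkl c i :=
  LinearMap.ext fun p => dunkl_comm_apply c i j p

end Dunkl

section DunklAlgebra

variable {ι : Type*} [DecidableEq ι] [Fintype ι]

/-- Substitution of Dunkl operators for the variables of a polynomial. -/
noncomputable def dunklPoly (c : ℂ) :
    MvPolynomial ι ℂ →ₐ[ℂ] Module.End ℂ (MvPolynomial ι ℂ) :=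
  haveI := Algebra.isMulCommutative_adjoin ℂ (s := Set.range (dunkl (ι := ι) c)) (by
    rintro _ ⟨i, rfl⟩ _ ⟨j, rfl⟩
    exact dunkl_comm c i j)
  open scoped IsMulCommutative in
  (Algebra.adjoin ℂ (Set.range (dunkl (ι := ι) c))).val.comp
    (aeval fun i => ⟨dunkl c i, Algebra.subset_adjoin ⟨i, rfl⟩⟩)

@[simp] theorem dunklPoly_X (c : ℂ) (i : ι) : dunklPoly c (X i) = dunkl c i := by
  simp [dunklPoly]

theorem dunklPoly_comm (c : ℂ) (p q : MvPolynomial ι ℂ) :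
    dunklPoly c p * dunklPoly c q = dunklPoly c q * dunklPoly c p := by
  rw [← map_mul, mul_comm, map_mul]

theorem rename_dunklPoly (c : ℂ) (σ : Equiv.Perm ι) (q p : MvPolynomial ι ℂ) :
    rename σ (dunklPoly c q p) = dunklPoly c (rename σ q) (rename σ p) := by
  induction q using MvPolynomial.induction_on generalizing p with
  | C r => simp [← algebraMap_eq, Module.algebraMap_end_apply]
  | add q r hq hr => simp [hq, hr]
  | mul_X q k hq => simp [Module.End.mul_apply, hq, rename_dunkl]

/-- The operator `∑ D_i`. -/
noncomputable def dunklT (c : ℂ) : Module.End ℂ (MvPolynomial ι ℂ) := ∑ i, dunkl c i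

/-- The operator `∑ X_i D_i ^ 2`. -/
noncomputable def dunklL (c : ℂ) : Module.End ℂ (MvPolynomial ι ℂ) :=
  ∑ i, LinearMap.mulLeft ℂ (X i) * (dunkl c i * dunkl c i)

theorem dunklL_apply (c : ℂ) (p : MvPolynomial ι ℂ) :
    dunklL c p = ∑ i, X i * dunkl c i (dunkl c i p) := by
  simp [dunklL]

theorem dunklT_apply (c : ℂ) (p : MvPolynomial ι ℂ) :
    dunklT c p = ∑ i, dunkl c i p := by
  simp [dunklT]

theorem dunkl_dunklL (c : ℂ) (j : ι) (p : MvPolynomial ι ℂ) :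
    dunkl c j (dunklL c p) = dunklL c (dunkl c j p) + dunkl c j (dunkl c j p) +
      c • ∑ i, (dunkl c j (dunkl c j (rename (Equiv.swap i j) p)) -
        dunkl c i (dunkl c i (rename (Equiv.swap i j) p))) := by
  have h1 : ∀ i ∈ Finset.univ.erase j, dunkl c j (X i * dunkl c i (dunkl c i p)) =
      X i * dunkl c i (dunkl c i (dunkl c j p)) +
        c • dunkl c j (dunkl c j (rename (Equiv.swap i j) p)) := by
    intro i hi
    rw [dunkl_X_mul_of_ne c (Finset.ne_of_mem_erase hi).symm, rename_dunkl, rename_dunkl,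
      Equiv.swap_apply_left, dunkl_comm_apply c j i, dunkl_comm_apply c j i]
  have h2 : dunkl c j (X j * dunkl c j (dunkl c j p)) =
      X j * dunkl c j (dunkl c j (dunkl c j p)) + dunkl c j (dunkl c j p) -
        c • ∑ i ∈ Finset.univ.erase j, dunkl c i (dunkl c i (rename (Equiv.swap i j) p)) := by
    rw [dunkl_X_mul_self]
    congr 2
    refine Finset.sum_congr rfl fun i _ => ?_
    rw [rename_dunkl, rename_dunkl, Equiv.swap_apply_left, Equiv.swap_comm]
  have h3 : dunklL c (dunkl c j p) = X j * dunkl c j (dunkl c j (dunkl c j p)) +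
      ∑ i ∈ Finset.univ.erase j, X i * dunkl c i (dunkl c i (dunkl c j p)) := by
    rw [dunklL_apply, ← Finset.add_sum_erase _ _ (Finset.mem_univ j)]
  have h4 : ∑ i, (dunkl c j (dunkl c j (rename (Equiv.swap i j) p)) -
        dunkl c i (dunkl c i (rename (Equiv.swap i j) p))) =
      ∑ i ∈ Finset.univ.erase j, dunkl c j (dunkl c j (rename (Equiv.swap i j) p)) -
      ∑ i ∈ Finset.univ.erase j, dunkl c i (dunkl c i (rename (Equiv.swap i j) p)) := by
    rw [← Finset.add_sum_erase _ _ (Finset.mem_univ j), sub_self, zero_add,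
      Finset.sum_sub_distrib]
  rw [dunklL_apply, map_sum, ← Finset.add_sum_erase _ _ (Finset.mem_univ j), h2,
    Finset.sum_congr rfl h1, Finset.sum_add_distrib, h3, h4, smul_sub, ← Finset.smul_sum]
  abel

theorem pow_mul_sub_mul_pow {A : Type*} [Ring A] (x y : A) (k : ℕ) :
    x ^ k * y - y * x ^ k = ∑ p ∈ Finset.range k, x ^ p * (x * y - y * x) * x ^ (k - 1 - p) := by
  induction k with
  | zero => simp
  | succ k ih =>
    have : x ^ (k + 1) * y - y * x ^ (k + 1) =
        x ^ k * (x * y - y * x) + (x ^ k * y - y * x ^ k) * x := by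
      rw [pow_succ]; noncomm_ring
    rw [this, ih, Finset.sum_range_succ, Finset.sum_mul, add_comm]
    congr 1
    · refine Finset.sum_congr rfl fun p hp => ?_
      have := Finset.mem_range.1 hp
      rw [mul_assoc _ _ x, ← pow_succ]
      congr 2; omega
    · simp

/-- The permutation action as a linear endomorphism. -/
noncomputable def renameEnd (σ : Equiv.Perm ι) : Module.End ℂ (MvPolynomial ι ℂ) :=
  (rename σ).toLinearMap

theorem renameEnd_mul_dunklPoly (c : ℂ) (σ : Equiv.Perm ι) (q : MvPolynomial ι ℂ) :
    renameEnd σ * dunklPoly c q = dunklPoly c (rename σ q) * renameEnd σ :=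
  LinearMap.ext fun p => rename_dunklPoly c σ q p

theorem dunklPoly_X_mul_dunklL (c : ℂ) (j : ι) :
    dunklPoly c (X j) * dunklL c - dunklL c * dunklPoly c (X j) = dunklPoly c (X j ^ 2) +
      c • ∑ i, dunklPoly c (X j ^ 2 - X i ^ 2) * renameEnd (Equiv.swap i j) := by
  refine LinearMap.ext fun p => ?_
  have := dunkl_dunklL c j p
  simp only [renameEnd, pow_two, map_sub, map_mul, dunklPoly_X, LinearMap.sub_apply,
    Module.End.mul_apply, LinearMap.add_apply, LinearMap.smul_apply, LinearMap.sum_apply,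
    AlgHom.toLinearMap_apply]
  rw [this]; abel

theorem sum_eq_zero_of_reflect {A : Type*} [AddCommGroup A] [Module ℂ A] {f : ι → ι → ℕ → A}
    {k : ℕ} (h : ∀ i j, ∀ p < k, f j i (k - 1 - p) + f i j p = 0) :
    ∑ j, ∑ p ∈ Finset.range k, ∑ i, f j i p = 0 := by
  have e : ∑ j, ∑ p ∈ Finset.range k, ∑ i, f j i p =
      - ∑ j, ∑ p ∈ Finset.range k, ∑ i, f j i p := by
    conv_lhs =>
      enter [2, j]
      rw [Finset.sum_comm]
    rw [Finset.sum_comm, ← Finset.sum_neg_distrib]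
    refine Finset.sum_congr rfl fun i _ => ?_
    rw [Finset.sum_comm, ← Finset.sum_range_reflect, ← Finset.sum_neg_distrib]
    refine Finset.sum_congr rfl fun p hp => ?_
    rw [← Finset.sum_neg_distrib]
    exact Finset.sum_congr rfl fun j _ => eq_neg_of_add_eq_zero_left (h i j p (Finset.mem_range.1 hp))
  have h2 : (2 : ℂ) • ∑ j, ∑ p ∈ Finset.range k, ∑ i, f j i p = 0 := by
    rw [two_smul]
    nth_rw 1 [e]
    exact neg_add_cancel _
  exact (smul_eq_zero.1 h2).resolve_left two_ne_zero

set_option maxHeartbeats 1000000 in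
theorem dunklPoly_psum_mul_dunklL (c : ℂ) (k : ℕ) :
    dunklPoly c (psum ι ℂ k) * dunklL c - dunklL c * dunklPoly c (psum ι ℂ k) =
      (k : ℂ) • dunklPoly c (psum ι ℂ (k + 1)) := by
  set f : ι → ι → ℕ → Module.End ℂ (MvPolynomial ι ℂ) := fun j i p =>
    dunklPoly c (X j ^ p * (X j ^ 2 - X i ^ 2) * X i ^ (k - 1 - p)) *
      renameEnd (Equiv.swap i j) with hf
  have h1 : ∀ j, ∀ p ∈ Finset.range k, dunklPoly c (X j) ^ p *
      (dunklPoly c (X j) * dunklL c - dunklL c * dunklPoly c (X j)) *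
        dunklPoly c (X j) ^ (k - 1 - p) = dunklPoly c (X j ^ (k + 1)) + c • ∑ i, f j i p := by
    intro j p hp
    have hp := Finset.mem_range.1 hp
    rw [dunklPoly_X_mul_dunklL, mul_add, add_mul, ← map_pow, ← map_pow, ← map_mul, ← map_mul]
    congr 1
    · rw [← pow_add, ← pow_add]
      congr 2; omega
    · rw [mul_smul_comm, smul_mul_assoc, Finset.mul_sum, Finset.sum_mul]
      congr 1
      refine Finset.sum_congr rfl fun i _ => ?_
      rw [hf, mul_assoc, mul_assoc, renameEnd_mul_dunklPoly, ← mul_assoc, ← mul_assoc, ← map_mul,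
        ← map_mul, map_pow, rename_X, Equiv.swap_apply_right]
  have h2 : ∑ j, ∑ p ∈ Finset.range k, ∑ i, f j i p = 0 := by
    refine sum_eq_zero_of_reflect fun i j p hp => ?_
    rw [hf]
    dsimp only
    rw [Equiv.swap_comm, ← add_mul, ← map_add, show k - 1 - (k - 1 - p) = p by omega]
    have e : (X j ^ (k - 1 - p) * (X j ^ 2 - X i ^ 2) * X i ^ p +
        X i ^ p * (X i ^ 2 - X j ^ 2) * X j ^ (k - 1 - p) : MvPolynomial ι ℂ) = 0 := by ring
    rw [e, map_zero, zero_mul]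
  have h3 : ∀ j, dunklPoly c (X j ^ k) * dunklL c - dunklL c * dunklPoly c (X j ^ k) =
      (k : ℂ) • dunklPoly c (X j ^ (k + 1)) + c • ∑ p ∈ Finset.range k, ∑ i, f j i p := by
    intro j
    rw [map_pow, pow_mul_sub_mul_pow, Finset.sum_congr rfl (h1 j), Finset.sum_add_distrib,
      Finset.sum_const, Finset.card_range, ← Finset.smul_sum, Nat.cast_smul_eq_nsmul]
  rw [psum, psum, map_sum, map_sum, Finset.sum_mul, Finset.mul_sum, ← Finset.sum_sub_distrib,
    Finset.sum_congr rfl fun j _ => h3 j, Finset.sum_add_distrib, ← Finset.smul_sum,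
    ← Finset.smul_sum, h2, smul_zero, add_zero]

/-- The derivation `∑ X_i ^ 2 ∂_i`. -/
noncomputable def sqDerivation : Derivation ℂ (MvPolynomial ι ℂ) (MvPolynomial ι ℂ) :=
  mkDerivation ℂ fun i => X i ^ 2

theorem sqDerivation_psum (k : ℕ) :
    sqDerivation (psum ι ℂ k) = (k : ℂ) • psum ι ℂ (k + 1) := by
  simp only [psum, map_sum, Derivation.leibniz_pow, sqDerivation, mkDerivation_X, Finset.smul_sum]
  refine Finset.sum_congr rfl fun i _ => ?_
  rcases k with _ | k
  · simp
  · rw [Nat.cast_smul_eq_nsmul, smul_eq_mul, ← pow_add]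
    congr 2

theorem sqDerivation_prod_X (s : Finset ι) :
    sqDerivation (∏ i ∈ s, X i : MvPolynomial ι ℂ) = (∑ i ∈ s, X i) * ∏ i ∈ s, X i := by
  induction s using Finset.induction_on with
  | empty => simp
  | insert i s hi ih =>
    rw [Finset.prod_insert hi, Derivation.leibniz, ih, Finset.sum_insert hi, sqDerivation,
      mkDerivation_X]
    simp only [smul_eq_mul]
    ring

/-- A subalgebra containing the power sums contains all symmetric polynomials. -/
theorem mem_of_psum_mem {A : Subalgebra ℂ (MvPolynomial ι ℂ)}
    (hA : ∀ k, psum ι ℂ (k + 1) ∈ A) {q : MvPolynomial ι ℂ} (hq : q.IsSymmetric) : q ∈ A := by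
  have he : ∀ k, esymm ι ℂ k ∈ A := by
    intro k
    induction k using Nat.strong_induction_on with
    | _ k ih =>
      rcases k with _ | k
      · rw [esymm_zero]; exact A.one_mem
      · have h := mul_esymm_eq_sum ι ℂ (k + 1)
        have h' : ((k + 1 : ℕ) : ℂ) • esymm ι ℂ (k + 1) ∈ A := by
          rw [Nat.cast_smul_eq_nsmul, nsmul_eq_mul, h]
          refine A.mul_mem (A.pow_mem (A.neg_mem A.one_mem) _) (A.sum_mem fun x hx => ?_)
          rw [Finset.mem_filter, Finset.HasAntidiagonal.mem_antidiagonal] at hx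
          obtain ⟨m, hm⟩ : ∃ m, x.2 = m + 1 := ⟨x.2 - 1, by omega⟩
          rw [hm]
          exact A.mul_mem (A.mul_mem (A.pow_mem (A.neg_mem A.one_mem) _) (ih _ hx.2)) (hA m)
        have := A.smul_mem h' (((k + 1 : ℕ) : ℂ)⁻¹)
        rwa [smul_smul, inv_mul_cancel₀ (Nat.cast_ne_zero.2 k.succ_ne_zero), one_smul] at this
  obtain ⟨p, hp⟩ := (esymmAlgEquiv ι ℂ (n := Fintype.card ι) rfl).surjective ⟨q, hq⟩
  have hp := congrArg Subtype.val hp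
  have h2 : ((esymmAlgEquiv ι ℂ (n := Fintype.card ι) rfl) p).val =
    aeval (fun i : Fin (Fintype.card ι) => esymm ι ℂ (i + 1)) p := esymmAlgHom_apply p
  rw [h2] at hp
  change _ = q at hp
  rw [← hp, aeval_def, eval₂_eq]
  exact A.sum_mem fun d _ => A.mul_mem (A.algebraMap_mem _)
    (A.prod_mem fun i _ => A.pow_mem (he _) _)

theorem dunklPoly_mul_dunklL (c : ℂ) {q : MvPolynomial ι ℂ} (hq : q.IsSymmetric) :
    dunklPoly c q * dunklL c = dunklL c * dunklPoly c q + dunklPoly c (sqDerivation q) := by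
  let A : Subalgebra ℂ (MvPolynomial ι ℂ) :=
    { carrier := {q | dunklPoly c q * dunklL c =
        dunklL c * dunklPoly c q + dunklPoly c (sqDerivation q)}
      mul_mem' := by
        intro p q hp hq
        simp only [Set.mem_ofPred_eq] at *
        rw [map_mul, mul_assoc, hq, mul_add, ← mul_assoc, hp, Derivation.leibniz, map_add,
          smul_eq_mul, smul_eq_mul, map_mul, map_mul, add_mul, mul_assoc,
          dunklPoly_comm c (sqDerivation p)]
        abel
      add_mem' := by
        intro p q hp hq
        simp only [Set.mem_ofPred_eq] at *
        rw [map_add, add_mul, hp, hq, map_add, map_add, mul_add]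
        abel
      algebraMap_mem' := by
        intro r
        simp only [Set.mem_ofPred_eq]
        rw [AlgHom.commutes, Derivation.map_algebraMap, map_zero, add_zero, Algebra.commutes] }
  refine mem_of_psum_mem (A := A) (fun k => ?_) hq
  change _ = _
  rw [sqDerivation_psum, map_smul, ← dunklPoly_psum_mul_dunklL]
  abel

theorem dunklPoly_psum_one (c : ℂ) : dunklPoly c (psum ι ℂ 1) = dunklT c := by
  simp [psum_one, dunklT]

/-- The algebra generated by `∑ D_i` and `∑ X_i D_i ^ 2`. -/
noncomputable def dunklAlg (ι : Type*) [DecidableEq ι] [Fintype ι] (c : ℂ) :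
    Subalgebra ℂ (Module.End ℂ (MvPolynomial ι ℂ)) :=
  Algebra.adjoin ℂ {dunklT c, dunklL c}

theorem dunklPoly_mem_dunklAlg (c : ℂ) {q : MvPolynomial ι ℂ} (hq : q.IsSymmetric) :
    dunklPoly c q ∈ dunklAlg ι c := by
  refine mem_of_psum_mem (A := (dunklAlg ι c).comap (dunklPoly c)) (fun k => ?_) hq
  rw [Subalgebra.mem_comap]
  have hL : dunklL c ∈ dunklAlg ι c := Algebra.subset_adjoin (by simp)
  induction k with
  | zero =>
    rw [zero_add, dunklPoly_psum_one]
    exact Algebra.subset_adjoin (by simp)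
  | succ k ih =>
    have h := dunklPoly_psum_mul_dunklL (ι := ι) c (k + 1)
    have h' := (dunklAlg ι c).smul_mem
      (sub_mem (mul_mem ih hL) (mul_mem hL ih)) (((k + 1 : ℕ) : ℂ)⁻¹)
    rwa [h, smul_smul, inv_mul_cancel₀ (Nat.cast_ne_zero.2 k.succ_ne_zero), one_smul] at h'

/-- The product of all Dunkl operators. -/
noncomputable def dunklN (c : ℂ) : Module.End ℂ (MvPolynomial ι ℂ) :=
  dunklPoly c (∏ i, X i)

theorem isSymmetric_prod_X : (∏ i, X i : MvPolynomial ι ℂ).IsSymmetric := by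
  intro σ
  simp only [map_prod, rename_X]
  exact Equiv.prod_comp σ fun i => (X i : MvPolynomial ι ℂ)

theorem dunklN_mem (c : ℂ) : dunklN c ∈ dunklAlg ι c :=
  dunklPoly_mem_dunklAlg c isSymmetric_prod_X

theorem dunklN_mul_dunklT (c : ℂ) : dunklN (ι := ι) c * dunklT c = dunklT c * dunklN c := by
  rw [dunklN, ← dunklPoly_psum_one, dunklPoly_comm]

theorem dunklN_mul_dunklL (c : ℂ) :
    dunklN (ι := ι) c * dunklL c = dunklL c * dunklN c + dunklT c * dunklN c := by
  rw [dunklN, dunklPoly_mul_dunklL c isSymmetric_prod_X, sqDerivation_prod_X,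
    ← dunklPoly_psum_one, psum_one, map_mul]

theorem exists_mul_dunklN_eq (c : ℂ) {x : Module.End ℂ (MvPolynomial ι ℂ)}
    (hx : x ∈ dunklAlg ι c) : ∃ y ∈ dunklAlg ι c, x * dunklN c = dunklN c * y := by
  have hT : dunklT c ∈ dunklAlg ι c := Algebra.subset_adjoin (by simp)
  have hL : dunklL c ∈ dunklAlg ι c := Algebra.subset_adjoin (by simp)
  induction hx using Algebra.adjoin_induction with
  | mem x hx =>
    rcases hx with rfl | rfl
    · exact ⟨_, hT, (dunklN_mul_dunklT c).symm⟩
    · refine ⟨dunklL c - dunklT c, sub_mem hL hT, ?_⟩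
      rw [mul_sub, dunklN_mul_dunklL, dunklN_mul_dunklT]; abel
  | algebraMap r => exact ⟨_, Subalgebra.algebraMap_mem _ r, Algebra.commutes _ _⟩
  | add x y _ _ hx hy =>
    obtain ⟨x', hx', ex⟩ := hx
    obtain ⟨y', hy', ey⟩ := hy
    exact ⟨_, add_mem hx' hy', by rw [add_mul, ex, ey, mul_add]⟩
  | mul x y _ _ hx hy =>
    obtain ⟨x', hx', ex⟩ := hx
    obtain ⟨y', hy', ey⟩ := hy
    exact ⟨_, mul_mem hx' hy', by rw [mul_assoc, ey, ← mul_assoc, ex, mul_assoc]⟩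

theorem exists_mul_dunklN_pow_eq (c : ℂ) (k : ℕ) {x : Module.End ℂ (MvPolynomial ι ℂ)}
    (hx : x ∈ dunklAlg ι c) : ∃ y ∈ dunklAlg ι c, x * dunklN c ^ k = dunklN c ^ k * y := by
  induction k generalizing x with
  | zero => exact ⟨x, hx, by simp⟩
  | succ k ih =>
    obtain ⟨y, hy, ey⟩ := exists_mul_dunklN_eq c hx
    obtain ⟨z, hz, ez⟩ := ih hy
    exact ⟨z, hz, by rw [pow_succ', ← mul_assoc, ey, mul_assoc, ez, mul_assoc]⟩

theorem exists_dunklN_mul_eq (c : ℂ) {x : Module.End ℂ (MvPolynomial ι ℂ)}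
    (hx : x ∈ dunklAlg ι c) : ∃ y, dunklN c * x = y * dunklN c := by
  induction hx using Algebra.adjoin_induction with
  | mem x hx =>
    rcases hx with rfl | rfl
    · exact ⟨_, dunklN_mul_dunklT c⟩
    · exact ⟨_, (dunklN_mul_dunklL c).trans (add_mul _ _ _).symm⟩
  | algebraMap r => exact ⟨_, (Algebra.commutes _ _).symm⟩
  | add x y _ _ hx hy =>
    obtain ⟨x', ex⟩ := hx
    obtain ⟨y', ey⟩ := hy
    exact ⟨x' + y', by rw [mul_add, ex, ey, add_mul]⟩
  | mul x y _ _ hx hy =>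
    obtain ⟨x', ex⟩ := hx
    obtain ⟨y', ey⟩ := hy
    exact ⟨x' * y', by rw [← mul_assoc, ex, mul_assoc, ey, mul_assoc]⟩

theorem rename_swap_prod_X {k l : ι} {s : Finset ι} (hk : k ∉ s) (hl : l ∉ s) :
    rename (Equiv.swap k l) (∏ i ∈ s, X i : MvPolynomial ι ℂ) = ∏ i ∈ s, X i := by
  rw [map_prod]
  refine Finset.prod_congr rfl fun i hi => ?_
  rw [rename_X, Equiv.swap_apply_of_ne_of_ne (ne_of_mem_of_not_mem hi hk)
    (ne_of_mem_of_not_mem hi hl)]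

theorem pderiv_prod_X_of_notMem {k : ι} {s : Finset ι} (hk : k ∉ s) :
    pderiv k (∏ i ∈ s, X i : MvPolynomial ι ℂ) = 0 := by
  induction s using Finset.induction_on with
  | empty => simp
  | insert i s hi ih =>
    rw [Finset.mem_insert, not_or] at hk
    rw [Finset.prod_insert hi, Derivation.leibniz, ih hk.2, pderiv_X_of_ne (Ne.symm hk.1)]
    simp

theorem pderiv_prod_pow_mul_prod (m : ℕ) {k : ι} {s : Finset ι} (hk : k ∉ s) :
    pderiv k ((∏ i, X i) ^ m * ∏ i ∈ insert k s, X i : MvPolynomial ι ℂ) =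
      ((m : ℂ) + 1) • ((∏ i, X i) ^ m * ∏ i ∈ s, X i) := by
  have h0 : pderiv k ((∏ i ∈ Finset.univ.erase k, X i) ^ m * ∏ i ∈ s, X i : MvPolynomial ι ℂ) =
      0 := by
    rw [Derivation.leibniz, Derivation.leibniz_pow, pderiv_prod_X_of_notMem hk,
      pderiv_prod_X_of_notMem (Finset.notMem_erase _ _)]
    simp
  have e : ((∏ i, X i) ^ m * ∏ i ∈ insert k s, X i : MvPolynomial ι ℂ) =
      X k ^ (m + 1) * ((∏ i ∈ Finset.univ.erase k, X i) ^ m * ∏ i ∈ s, X i) := by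
    rw [Finset.prod_insert hk, ← Finset.mul_prod_erase _ _ (Finset.mem_univ k)]
    ring
  rw [e, Derivation.leibniz, h0, Derivation.leibniz_pow, pderiv_X_self,
    ← Finset.mul_prod_erase _ _ (Finset.mem_univ k), Nat.add_sub_cancel, smul_eq_C_mul]
  simp only [smul_eq_mul, nsmul_eq_mul, map_add, map_natCast, map_one]
  push_cast
  ring

theorem dunkl_prod_pow_mul_prod (c : ℂ) (m : ℕ) {k : ι} {s : Finset ι} (hk : k ∉ s) :
    dunkl c k ((∏ i, X i) ^ m * ∏ i ∈ insert k s, X i) =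
      ((m : ℂ) + 1 - c * ((insert k s)ᶜ.card : ℂ)) • ((∏ i, X i) ^ m * ∏ i ∈ s, X i) := by
  have hd : ∀ l, divDiff k l ((∏ i, X i) ^ m * ∏ i ∈ insert k s, X i : MvPolynomial ι ℂ) =
      if l ∈ (insert k s)ᶜ then (∏ i, X i) ^ m * ∏ i ∈ s, X i else 0 := by
    intro l
    rw [divDiff_mul (by rw [map_pow, isSymmetric_prod_X])]
    split_ifs with h
    · rw [Finset.mem_compl, Finset.mem_insert, not_or] at h
      rw [Finset.prod_insert hk, mul_comm (X k), divDiff_mul (rename_swap_prod_X hk h.2)]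
      congr 1
      have := divDiff_X_mul_left (Ne.symm h.1) (1 : MvPolynomial ι ℂ)
      rw [divDiff_eq_zero (p := 1) (map_one _), mul_one, mul_zero, zero_add, map_one (rename _)] at this
      rw [this, mul_one]
    · rw [Finset.mem_compl, not_not] at h
      rw [divDiff_eq_zero, mul_zero]
      rw [map_prod]
      simp only [rename_X]
      refine Finset.prod_equiv (Equiv.swap k l) (fun i => ?_) fun i _ => rfl
      rcases eq_or_ne i k with rfl | hik
      · simp [h]
      rcases eq_or_ne i l with rfl | hil
      · simp [h]
      rw [Equiv.swap_apply_of_ne_of_ne hik hil]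
  rw [dunkl_apply, pderiv_prod_pow_mul_prod m hk, Finset.sum_congr rfl fun l _ => hd l,
    Finset.sum_ite_mem, Finset.univ_inter, Finset.sum_const, ← Nat.cast_smul_eq_nsmul ℂ,
    smul_smul, sub_smul]

theorem dunklN_prod_pow (c : ℂ) (m : ℕ) :
    dunklN c ((∏ i : ι, X i) ^ (m + 1)) =
      (∏ i ∈ Finset.range (Fintype.card ι), ((m : ℂ) + 1 - c * i)) • (∏ i : ι, X i) ^ m := by
  have h : ∀ t : Finset ι, dunklPoly c (∏ i ∈ t, X i) ((∏ i : ι, X i) ^ m * ∏ i, X i) =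
      (∏ i ∈ Finset.range t.card, ((m : ℂ) + 1 - c * i)) •
        ((∏ i : ι, X i) ^ m * ∏ i ∈ tᶜ, X i) := by
    intro t
    induction t using Finset.induction_on with
    | empty => simp
    | insert k t hk ih =>
      have hc : tᶜ = insert k (insert k t)ᶜ := by
        ext i
        by_cases hik : i = k
        · simp [hik, hk]
        · simp [hik]
      rw [Finset.prod_insert hk, map_mul (dunklPoly c), Module.End.mul_apply, ih, map_smul, hc, dunklPoly_X,
        dunkl_prod_pow_mul_prod c m (by simp), ← hc, compl_compl, Finset.card_insert_of_notMem hk,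
        Finset.prod_range_succ, smul_smul]
  rw [dunklN, pow_succ, h, Finset.compl_univ, Finset.prod_empty, mul_one, Finset.card_univ]

end DunklAlgebra

section Singular

variable {ι : Type*} [DecidableEq ι]

theorem coeff_divDiff_single {i j : ι} (h : i ≠ j) (m : ℕ) (p : MvPolynomial ι ℂ) :
    coeff (Finsupp.single i m) (divDiff i j p) =
      coeff (Finsupp.single i (m + 1)) p - coeff (Finsupp.single j (m + 1)) p := by
  have e := congrArg (coeff (Finsupp.single i (m + 1))) (X_sub_X_mul_divDiff i j p)
  rw [sub_mul, coeff_sub, coeff_sub, coeff_X_mul', coeff_X_mul', if_pos (by simp), if_neg,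
    sub_zero, ← Finsupp.single_tsub, Nat.add_sub_cancel] at e
  · rw [e]
    congr 1
    have := coeff_rename_mapDomain (Equiv.swap i j) (Equiv.swap i j).injective p
      (Finsupp.single j (m + 1))
    rwa [Finsupp.mapDomain_single, Equiv.swap_apply_right] at this
  · rw [Finsupp.mem_support_iff, not_not, Finsupp.single_eq_of_ne h.symm]

variable [Fintype ι]

/-- Homogeneous polynomials of degree `m` killed by all Dunkl operators. -/
noncomputable def singularSubmodule (ι : Type*) [DecidableEq ι] [Fintype ι] (c : ℂ) (m : ℕ) :
    Submodule ℂ (MvPolynomial ι ℂ) :=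
  homogeneousSubmodule ι ℂ m ⊓ ⨅ i, LinearMap.ker (dunkl c i)

theorem mem_singularSubmodule {c : ℂ} {m : ℕ} {v : MvPolynomial ι ℂ} :
    v ∈ singularSubmodule ι c m ↔ v.IsHomogeneous m ∧ ∀ i, dunkl c i v = 0 := by
  simp [singularSubmodule]

theorem rename_mem_singularSubmodule {c : ℂ} {m : ℕ} {v : MvPolynomial ι ℂ}
    (hv : v ∈ singularSubmodule ι c m) (σ : Equiv.Perm ι) :
    rename σ v ∈ singularSubmodule ι c m := by
  rw [mem_singularSubmodule] at hv ⊢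
  refine ⟨hv.1.rename_isHomogeneous, fun i => ?_⟩
  have := rename_dunkl c σ (σ.symm i) v
  rw [hv.2, map_zero, Equiv.apply_symm_apply] at this
  exact this.symm

theorem coeff_rename_perm (σ : Equiv.Perm ι) (v : MvPolynomial ι ℂ) (i : ι) (m : ℕ) :
    coeff (Finsupp.single i m) (rename σ v) = coeff (Finsupp.single (σ.symm i) m) v := by
  have := coeff_rename_mapDomain σ σ.injective v (Finsupp.single (σ.symm i) m)
  rwa [Finsupp.mapDomain_single, Equiv.apply_symm_apply] at this

theorem natCast_mul_coeff_single {c : ℂ} {m : ℕ} {v : MvPolynomial ι ℂ}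
    (hv : v ∈ singularSubmodule ι c (m + 1)) (i : ι) :
    ((m : ℂ) + 1) * coeff (Finsupp.single i (m + 1)) v =
      c * ∑ j, (coeff (Finsupp.single i (m + 1)) v - coeff (Finsupp.single j (m + 1)) v) := by
  have h := congrArg (coeff (Finsupp.single i m)) ((mem_singularSubmodule.1 hv).2 i)
  rw [dunkl_apply, coeff_sub, coeff_smul, coeff_sum, coeff_zero, sub_eq_zero, coeff_pderiv] at h
  rw [← Finsupp.single_add, Finsupp.single_eq_same] at h
  rw [mul_comm, h, smul_eq_mul]
  congr 1
  refine Finset.sum_congr rfl fun j _ => ?_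
  rcases eq_or_ne i j with rfl | hj
  · simp
  · exact coeff_divDiff_single hj m v

theorem pderiv_pderiv_comm (i j : ι) (p : MvPolynomial ι ℂ) :
    pderiv i (pderiv j p) = pderiv j (pderiv i p) := by
  simpa [dunkl_apply] using dunkl_comm_apply 0 i j p

theorem coeff_ne_zero_of_relation {a : ℕ} {i₀ : ι} {F : MvPolynomial ι ℂ} {m : ℕ}
    (hF : ∀ i j, (X i - X j) * pderiv i (pderiv j F) =
      (a : ℂ) • (pderiv j F - pderiv i F))
    (h0 : coeff (Finsupp.single i₀ m) F ≠ 0) :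
    ∀ (k : ℕ) (e : ι →₀ ℕ), (∑ i, e i = m) → (∀ j ≠ i₀, e j ≤ a) →
      ∑ i ∈ Finset.univ.erase i₀, e i = k → coeff e F ≠ 0 := by
  have rel : ∀ (i j : ι) (s : ι →₀ ℕ), i ≠ j →
      ((s i : ℂ) - a) * ((s j + 1) * coeff (s + Finsupp.single j 1) F) =
      (s j - a) * ((s i + 1) * coeff (s + Finsupp.single i 1) F) := by
    intro i j s hij
    have hx : ∀ (i j : ι), i ≠ j → coeff s (X i * pderiv i (pderiv j F)) =
        s i * ((s j + 1) * coeff (s + Finsupp.single j 1) F) := by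
      intro i j hij
      rw [coeff_X_mul']
      split_ifs with h
      · have h1 : 1 ≤ s i := Nat.one_le_iff_ne_zero.2 (Finsupp.mem_support_iff.1 h)
        have h2 : s - Finsupp.single i 1 + Finsupp.single i 1 = s :=
          tsub_add_cancel_of_le (Finsupp.single_le_iff.2 h1)
        rw [coeff_pderiv, h2, coeff_pderiv]
        simp only [Finsupp.coe_tsub, Pi.sub_apply, Finsupp.single_eq_same]
        rw [Nat.cast_sub h1]
        push_cast; ring
      · rw [Finsupp.notMem_support_iff.1 h]; simp
    have h := congrArg (coeff s) (hF i j)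
    rw [sub_mul, coeff_sub, hx i j hij, pderiv_pderiv_comm i j F, hx j i hij.symm, coeff_smul, coeff_sub,
      coeff_pderiv, coeff_pderiv, smul_eq_mul] at h
    linear_combination h
  intro k
  induction k with
  | zero =>
    intro e he _ hk
    have : e = Finsupp.single i₀ m := by
      ext j
      rcases eq_or_ne j i₀ with rfl | hj
      · rw [← Finset.add_sum_erase _ _ (Finset.mem_univ j), hk, add_zero] at he
        simpa using he
      · rw [Finsupp.single_eq_of_ne hj]
        exact Finset.sum_eq_zero_iff.1 hk j (Finset.mem_erase.2 ⟨hj, Finset.mem_univ j⟩)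
    rwa [this]
  | succ k ih =>
    intro e he hle hk
    obtain ⟨j, hj, hj1⟩ : ∃ j ∈ Finset.univ.erase i₀, e j ≠ 0 := by
      by_contra! h
      rw [Finset.sum_eq_zero h] at hk
      omega
    have hj0 := Finset.ne_of_mem_erase hj
    obtain ⟨s, rfl⟩ : ∃ s : ι →₀ ℕ, e = s + Finsupp.single j 1 :=
      ⟨e - Finsupp.single j 1, (tsub_add_cancel_of_le
        (Finsupp.single_le_iff.2 (Nat.one_le_iff_ne_zero.2 hj1))).symm⟩
    have hs : ∑ i, (s + Finsupp.single i₀ 1 : ι →₀ ℕ) i = m := by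
      rw [← he]
      simp [Finset.sum_add_distrib, Finsupp.single_apply]
    have hk' : ∑ i ∈ Finset.univ.erase i₀, (s + Finsupp.single i₀ 1 : ι →₀ ℕ) i = k := by
      have h1 : ∑ i ∈ Finset.univ.erase i₀, (s + Finsupp.single i₀ 1 : ι →₀ ℕ) i =
          ∑ i ∈ Finset.univ.erase i₀, s i :=
        Finset.sum_congr rfl fun i hi => by
          simp [Finsupp.single_eq_of_ne (Finset.ne_of_mem_erase hi)]
      have h2 : ∑ i ∈ Finset.univ.erase i₀, (s + Finsupp.single j 1 : ι →₀ ℕ) i =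
          ∑ i ∈ Finset.univ.erase i₀, s i + 1 := by
        simp only [Finsupp.add_apply, Finset.sum_add_distrib]
        rw [Finset.sum_eq_single_of_mem j hj fun i _ hi => Finsupp.single_eq_of_ne hi]
        simp
      omega
    have h3 := ih (s + Finsupp.single i₀ 1) hs (fun l hl => by
      have := hle l hl
      simp only [Finsupp.add_apply, Finsupp.single_eq_of_ne hl] at this ⊢
      omega) hk'
    have h4 := hle j hj0
    simp only [Finsupp.add_apply, Finsupp.single_eq_same] at h4
    intro hz
    have := rel i₀ j s hj0.symm
    rw [hz, mul_zero, mul_zero] at this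
    have h5 : (s j : ℂ) - a ≠ 0 := sub_ne_zero.2 (by exact_mod_cast (by omega : s j ≠ a))
    have h6 : (s i₀ : ℂ) + 1 ≠ 0 := Nat.cast_add_one_ne_zero _
    exact mul_ne_zero h5 (mul_ne_zero h6 h3) this.symm


theorem singularSubmodule_eq_bot_of_coeff {a : ℕ} {m : ℕ}
    (inj : ∀ v ∈ singularSubmodule ι (a : ℂ) (m + 1),
      (∀ i, coeff (Finsupp.single i (m + 1)) v = 0) → v = 0) :
    singularSubmodule ι (a : ℂ) (m + 1) = ⊥ := by
  rw [eq_bot_iff]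
  intro v hv
  rw [Submodule.mem_bot]
  by_contra hv0
  set N := Fintype.card ι with hN
  obtain ⟨i₀, hi₀⟩ : ∃ i, coeff (Finsupp.single i (m + 1)) v ≠ 0 := by
    by_contra! h
    exact hv0 (inj v hv h)
  have hm1 : (m : ℂ) + 1 ≠ 0 := Nat.cast_add_one_ne_zero _
  have hsum : ∀ u ∈ singularSubmodule ι (a : ℂ) (m + 1),
      ∑ i, coeff (Finsupp.single i (m + 1)) u = 0 := by
    intro u hu
    have h := Finset.sum_congr rfl fun i (_ : i ∈ Finset.univ) => natCast_mul_coeff_single hu i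
    rw [← Finset.mul_sum, ← Finset.mul_sum] at h
    simp only [Finset.sum_sub_distrib] at h
    rw [Finset.sum_comm, sub_self, mul_zero] at h
    exact (mul_eq_zero.1 h).resolve_left hm1
  have hmN : m + 1 = a * N := by
    have h := natCast_mul_coeff_single hv i₀
    rw [Finset.sum_sub_distrib, hsum v hv, sub_zero, Finset.sum_const, Finset.card_univ,
      nsmul_eq_mul, ← mul_assoc] at h
    exact_mod_cast mul_right_cancel₀ hi₀ h
  let val : MvPolynomial ι ℂ →ₗ[ℂ] (ι → ℂ) :=
    LinearMap.pi fun i => lcoeff ℂ (Finsupp.single i (m + 1))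
  have hval : ∀ u i, val u i = coeff (Finsupp.single i (m + 1)) u := fun u i => rfl
  let U := (singularSubmodule ι (a : ℂ) (m + 1)).map val
  have hval_rename : ∀ (σ : Equiv.Perm ι) u, val (rename σ u) = fun i => val u (σ.symm i) :=
    fun σ u => funext fun i => coeff_rename_perm σ u i (m + 1)
  have hUperm : ∀ (σ : Equiv.Perm ι), ∀ u ∈ U, (fun i => u (σ.symm i)) ∈ U := by
    rintro σ _ ⟨u, hu, rfl⟩
    exact ⟨rename σ u, rename_mem_singularSubmodule hu σ, hval_rename σ u⟩
  obtain ⟨i₁, hi₁⟩ : ∃ i, val v i ≠ val v i₀ := by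
    by_contra! h
    have h1 := hsum v hv
    simp only [← hval, h] at h1
    rw [Finset.sum_const, Finset.card_univ, nsmul_eq_mul, mul_eq_zero] at h1
    rcases h1 with h1 | h1
    · rw [← hN] at h1
      have : N = 0 := by exact_mod_cast h1
      rw [this] at hmN
      omega
    · exact hi₀ h1
  have hi₁₀ : i₁ ≠ i₀ := fun e => hi₁ (by rw [e])
  have hdiff : ∀ k l : ι, (Pi.single k 1 - Pi.single l 1 : ι → ℂ) ∈ U := by
    have h01 : (Pi.single i₁ 1 - Pi.single i₀ 1 : ι → ℂ) ∈ U := by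
      have h1 : val v ∈ U := Submodule.mem_map_of_mem hv
      have h2 := U.smul_mem (val v i₁ - val v i₀)⁻¹
        (U.sub_mem h1 (hUperm (Equiv.swap i₁ i₀) _ h1))
      convert h2 using 1
      have h3 : val v i₁ - val v i₀ ≠ 0 := sub_ne_zero.2 hi₁
      ext i
      simp only [Pi.sub_apply, Pi.smul_apply, smul_eq_mul, Equiv.symm_swap]
      rcases eq_or_ne i i₁ with rfl | h
      · rw [Equiv.swap_apply_left, Pi.single_eq_same, Pi.single_eq_of_ne hi₁₀,
          inv_mul_cancel₀ h3, sub_zero]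
      rcases eq_or_ne i i₀ with rfl | h'
      · rw [Equiv.swap_apply_right, Pi.single_eq_same, Pi.single_eq_of_ne h]
        field_simp
        ring
      · rw [Equiv.swap_apply_of_ne_of_ne h h', Pi.single_eq_of_ne h, Pi.single_eq_of_ne h']
        simp
    have hperm : ∀ (σ : Equiv.Perm ι) (k l : ι), (Pi.single k 1 - Pi.single l 1 : ι → ℂ) ∈ U →
        (Pi.single (σ k) 1 - Pi.single (σ l) 1 : ι → ℂ) ∈ U := by
      intro σ k l h
      convert hUperm σ _ h using 1
      ext i
      simp [Pi.single_apply, Equiv.symm_apply_eq]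
    intro k l
    rcases eq_or_ne k l with rfl | hkl
    · simp
    have h1 := hperm (Equiv.swap i₁ k) _ _ h01
    rw [Equiv.swap_apply_left] at h1
    have h2 : Equiv.swap i₁ k i₀ ≠ k := by
      intro h
      apply hi₁₀
      exact ((Equiv.swap i₁ k).injective (h.trans (Equiv.swap_apply_left i₁ k).symm)).symm
    have h3 := hperm (Equiv.swap (Equiv.swap i₁ k i₀) l) _ _ h1
    rwa [Equiv.swap_apply_left, Equiv.swap_apply_of_ne_of_ne h2.symm hkl] at h3
  have hG : ∀ i, ∃ g ∈ singularSubmodule ι (a : ℂ) (m + 1),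
      val g = fun k => (if k = i then (N : ℂ) else 0) - 1 := by
    intro i
    have h := U.sum_mem fun l (_ : l ∈ Finset.univ) => hdiff i l
    have e : ∑ l, (Pi.single i 1 - Pi.single l 1 : ι → ℂ) =
        fun k => (if k = i then (N : ℂ) else 0) - 1 := by
      ext k
      simp [Finset.sum_sub_distrib, Pi.single_apply, hN]
    rw [e] at h
    exact h
  choose G hGmem hGval using hG
  have ext_val : ∀ u ∈ singularSubmodule ι (a : ℂ) (m + 1),
      ∀ w ∈ singularSubmodule ι (a : ℂ) (m + 1), val u = val w → u = w := by
    intro u hu w hw h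
    refine sub_eq_zero.1 (inj _ (Submodule.sub_mem _ hu hw) fun i => ?_)
    have := congrFun h i
    rw [coeff_sub, ← hval, ← hval, this, sub_self]
  have hGperm : ∀ (σ : Equiv.Perm ι) i, rename σ (G i) = G (σ i) := by
    intro σ i
    refine ext_val _ (rename_mem_singularSubmodule (hGmem i) σ) _ (hGmem _) ?_
    rw [hval_rename, hGval, hGval]
    simp [Equiv.symm_apply_eq]
  have hGsum : ∑ i, G i = 0 := by
    refine ext_val _ (Submodule.sum_mem _ fun i _ => hGmem i) _ (Submodule.zero_mem _) ?_
    rw [map_sum, map_zero]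
    ext k
    simp [hGval, hN]
  have hGd : ∀ i j, i ≠ j → pderiv j (G i) = (a : ℂ) • divDiff j i (G i) := by
    intro i j hij
    have h := (mem_singularSubmodule.1 (hGmem i)).2 j
    rw [dunkl_apply, sub_eq_zero, Finset.sum_eq_single_of_mem i (Finset.mem_univ _)] at h
    · exact h
    · intro l _ hl
      exact divDiff_eq_zero (by rw [hGperm, Equiv.swap_apply_of_ne_of_ne hij hl.symm])
  have hGdd : ∀ i j, (X i - X j) * pderiv i (G j) = (a : ℂ) • (G j - G i) := by
    intro i j
    rcases eq_or_ne i j with rfl | hij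
    · simp
    · rw [hGd j i hij.symm, mul_smul_comm, X_sub_X_mul_divDiff, hGperm, Equiv.swap_apply_right]
  have hGsymm : ∀ i j, pderiv j (G i) = pderiv i (G j) := by
    intro i j
    rcases eq_or_ne i j with rfl | hij
    · rfl
    · apply mul_left_cancel₀ (X_sub_X_ne_zero hij)
      rw [hGdd i j, ← neg_sub (X j), neg_mul, hGdd j i, ← smul_neg, neg_sub]
  let F : MvPolynomial ι ℂ := ∑ i, X i * G i
  have hFd : ∀ j, pderiv j F = ((m : ℂ) + 1 + 1) • G j := by
    intro j
    have h1 : ∑ i, X i * pderiv j (G i) = ((m : ℂ) + 1) • G j := by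
      have := ((mem_singularSubmodule.1 (hGmem j)).1).sum_X_mul_pderiv
      simp only [hGsymm _ j]
      rw [this, ← Nat.cast_smul_eq_nsmul ℂ]
      push_cast; rfl
    simp only [F, map_sum, Derivation.leibniz, Finset.sum_add_distrib, smul_eq_mul]
    rw [h1, Finset.sum_eq_single_of_mem j (Finset.mem_univ j), pderiv_X_self, mul_one]
    · module
    · intro i _ hi
      rw [pderiv_X_of_ne hi, mul_zero]
  have hFrel : ∀ i j, (X i - X j) * pderiv i (pderiv j F) =
      (a : ℂ) • (pderiv j F - pderiv i F) := by
    intro i j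
    rw [hFd, hFd, Derivation.map_smul, mul_smul_comm, hGdd, ← smul_sub, smul_comm]
  have hFperm : ∀ σ : Equiv.Perm ι, rename σ F = F := by
    intro σ
    simp only [F, map_sum, map_mul, rename_X, hGperm]
    exact Equiv.sum_comp σ fun i => X i * G i
  have hm2 : (m : ℂ) + 1 + 1 ≠ 0 := by exact_mod_cast Nat.succ_ne_zero (m + 1)
  have hN2 : (N : ℂ) - 1 ≠ 0 := by
    have : 1 < N := Fintype.one_lt_card_iff.2 ⟨i₁, i₀, hi₁₀⟩
    rw [sub_ne_zero]
    exact_mod_cast this.ne'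
  have hbase : coeff (Finsupp.single i₀ (m + 1 + 1)) F ≠ 0 := by
    intro h
    have h1 := congrArg (coeff (Finsupp.single i₀ (m + 1))) (hFd i₀)
    rw [coeff_pderiv, ← Finsupp.single_add, h, zero_mul, coeff_smul, ← hval, hGval] at h1
    simp only [if_true, smul_eq_mul] at h1
    exact mul_ne_zero hm2 hN2 h1.symm
  let s : ι →₀ ℕ := Finsupp.equivFunOnFinite.symm fun _ => a
  have hs : ∀ i, s i = a := fun i => rfl
  have hne := coeff_ne_zero_of_relation hFrel hbase _ (s + Finsupp.single i₀ 1)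
    (by simp [Finset.sum_add_distrib, Finsupp.single_apply, hs, hmN, hN, mul_comm])
    (fun j hj => by simp [hs, Finsupp.single_eq_of_ne hj]) rfl
  have hall : ∀ j, coeff (s + Finsupp.single j 1) F = coeff (s + Finsupp.single i₀ 1) F := by
    intro j
    have h1 := coeff_rename_mapDomain (Equiv.swap i₀ j) (Equiv.swap i₀ j).injective F
      (s + Finsupp.single i₀ 1)
    rw [hFperm, Finsupp.mapDomain_add, Finsupp.mapDomain_single, Equiv.swap_apply_left] at h1
    rw [← h1]
    congr 2
    ext i
    rw [Finsupp.mapDomain_equiv_apply, hs, hs]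
  have hfin : ∑ j, pderiv j F = 0 := by
    simp only [hFd]
    rw [← Finset.smul_sum, hGsum, smul_zero]
  have h2 := congrArg (coeff s) hfin
  rw [coeff_sum, coeff_zero] at h2
  simp only [coeff_pderiv, hall, hs] at h2
  rw [Finset.sum_const, Finset.card_univ, nsmul_eq_mul, ← hN] at h2
  have hN0 : (N : ℂ) ≠ 0 := by
    have : N ≠ 0 := by
      intro h
      rw [h] at hmN
      omega
    exact_mod_cast this
  exact mul_ne_zero hN0 (mul_ne_zero hne (by exact_mod_cast Nat.succ_ne_zero a)) h2

end Singular

section NoSingular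

variable {n : ℕ}

/-- The coefficient of `(X 0)^k`, as a polynomial in the remaining variables. -/
noncomputable def zcoeff (k : ℕ) : MvPolynomial (Fin (n + 1)) ℂ →ₗ[ℂ] MvPolynomial (Fin n) ℂ :=
  ((Polynomial.lcoeff (MvPolynomial (Fin n) ℂ) k).restrictScalars ℂ) ∘ₗ
    (finSuccEquiv ℂ n).toLinearMap

theorem zcoeff_apply (k : ℕ) (p : MvPolynomial (Fin (n + 1)) ℂ) :
    zcoeff k p = (finSuccEquiv ℂ n p).coeff k := rfl

theorem coeff_zcoeff (k : ℕ) (p : MvPolynomial (Fin (n + 1)) ℂ) (e : Fin n →₀ ℕ) :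
    coeff e (zcoeff k p) = coeff (e.cons k) p := finSuccEquiv_coeff_coeff e p k

theorem zcoeff_X_succ_mul (k : ℕ) (j : Fin n) (p : MvPolynomial (Fin (n + 1)) ℂ) :
    zcoeff k (X j.succ * p) = X j * zcoeff k p := by
  rw [zcoeff_apply, map_mul, finSuccEquiv_X_succ, Polynomial.coeff_C_mul, zcoeff_apply]

theorem finSuccEquiv_rename_swap (i j : Fin n) (p : MvPolynomial (Fin (n + 1)) ℂ) :
    finSuccEquiv ℂ n (rename (Equiv.swap i.succ j.succ) p) =
      Polynomial.map (rename (Equiv.swap i j)).toRingHom (finSuccEquiv ℂ n p) := by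
  induction p using MvPolynomial.induction_on with
  | C r => simp [finSuccEquiv_apply]
  | add p q hp hq => simp only [map_add, hp, hq, Polynomial.map_add]
  | mul_X p k hp =>
    have key : finSuccEquiv ℂ n (X (Equiv.swap i.succ j.succ k)) =
        Polynomial.map (rename (Equiv.swap i j)).toRingHom (finSuccEquiv ℂ n (X k)) := by
      rcases Fin.eq_zero_or_eq_succ k with rfl | ⟨l, rfl⟩
      · rw [Equiv.swap_apply_of_ne_of_ne (Fin.succ_ne_zero _).symm (Fin.succ_ne_zero _).symm,
          finSuccEquiv_X_zero, Polynomial.map_X]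
      · have : Equiv.swap i.succ j.succ l.succ = (Equiv.swap i j l).succ := by
          simp only [Equiv.swap_apply_def, Fin.succ_inj]
          split_ifs <;> rfl
        rw [this, finSuccEquiv_X_succ, finSuccEquiv_X_succ, Polynomial.map_C]
        exact congrArg Polynomial.C (rename_X _ _).symm
    rw [map_mul (rename _), map_mul (finSuccEquiv ℂ n), map_mul (finSuccEquiv ℂ n),
      Polynomial.map_mul, hp, rename_X, key]

theorem zcoeff_rename_swap (k : ℕ) (i j : Fin n) (p : MvPolynomial (Fin (n + 1)) ℂ) :
    zcoeff k (rename (Equiv.swap i.succ j.succ) p) = rename (Equiv.swap i j) (zcoeff k p) := by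
  rw [zcoeff_apply, finSuccEquiv_rename_swap, Polynomial.coeff_map, zcoeff_apply]; rfl

theorem zcoeff_divDiff_succ (k : ℕ) (i j : Fin n) (p : MvPolynomial (Fin (n + 1)) ℂ) :
    zcoeff k (divDiff i.succ j.succ p) = divDiff i j (zcoeff k p) := by
  rcases eq_or_ne i j with rfl | h
  · simp
  · symm
    apply divDiff_eq_of h
    rw [← zcoeff_rename_swap, ← map_sub, ← X_sub_X_mul_divDiff, sub_mul, sub_mul, map_sub,
      zcoeff_X_succ_mul, zcoeff_X_succ_mul]

theorem zcoeff_pderiv_succ (k : ℕ) (j : Fin n) (p : MvPolynomial (Fin (n + 1)) ℂ) :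
    zcoeff k (pderiv j.succ p) = pderiv j (zcoeff k p) := by
  ext e
  rw [coeff_zcoeff, coeff_pderiv, coeff_pderiv, coeff_zcoeff, Finsupp.cons_succ]
  congr 2
  ext l
  refine Fin.cases ?_ (fun l => ?_) l
  · simp
  · simp [Finsupp.single_apply]

theorem zcoeff_divDiff_zero {k : ℕ} {j : Fin n} {p : MvPolynomial (Fin (n + 1)) ℂ}
    (h1 : ∀ l, k < l → zcoeff l p = 0)
    (h2 : ∀ l, k < l → zcoeff l (rename (Equiv.swap j.succ 0) p) = 0) :
    zcoeff k (divDiff j.succ 0 p) = 0 := by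
  have e := congrArg (finSuccEquiv ℂ n) (X_sub_X_mul_divDiff j.succ 0 p)
  rw [map_mul, map_sub, finSuccEquiv_X_succ, finSuccEquiv_X_zero] at e
  have hd : (finSuccEquiv ℂ n (p - rename (Equiv.swap j.succ 0) p)).natDegree ≤ k := by
    rw [Polynomial.natDegree_le_iff_coeff_eq_zero]
    intro l hl
    rw [← zcoeff_apply, map_sub, h1 l hl, h2 l hl, sub_zero]
  rw [← e] at hd
  rw [zcoeff_apply]
  set D := finSuccEquiv ℂ n (divDiff j.succ 0 p)
  by_cases hD : D = 0
  · simp [hD]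
  apply Polynomial.coeff_eq_zero_of_natDegree_lt
  have h3 : (Polynomial.C (X j : MvPolynomial (Fin n) ℂ) - Polynomial.X).natDegree = 1 := by
    rw [← Polynomial.natDegree_neg, neg_sub, Polynomial.natDegree_X_sub_C]
  rw [Polynomial.natDegree_mul (fun h => by simp [h] at h3) hD, h3] at hd
  omega

theorem dunkl_zcoeff {c : ℂ} {k : ℕ} {p : MvPolynomial (Fin (n + 1)) ℂ}
    (h : ∀ i, dunkl c i p = 0)
    (h1 : ∀ l, k < l → zcoeff l p = 0)
    (h2 : ∀ (j : Fin n) l, k < l → zcoeff l (rename (Equiv.swap j.succ 0) p) = 0) (j : Fin n) :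
    dunkl c j (zcoeff k p) = 0 := by
  have e := congrArg (zcoeff k) (h j.succ)
  rw [dunkl_apply, Fin.sum_univ_succ, map_sub, map_smul, map_add, zcoeff_divDiff_zero h1 (h2 j),
    map_sum, zcoeff_pderiv_succ, map_zero, zero_add] at e
  simp only [zcoeff_divDiff_succ] at e
  rw [dunkl_apply, e]

theorem singularSubmodule_fin_eq_bot (a : ℕ) (n m : ℕ) :
    singularSubmodule (Fin n) (a : ℂ) (m + 1) = ⊥ := by
  induction n generalizing m with
  | zero =>
    rw [eq_bot_iff]
    intro v hv
    rw [Submodule.mem_bot]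
    ext e
    rw [coeff_zero]
    apply (mem_singularSubmodule.1 hv).1.coeff_eq_zero
    rw [Subsingleton.elim e 0]
    simp
  | succ n ih =>
    apply singularSubmodule_eq_bot_of_coeff
    intro v hv hval
    have key : ∀ t k, k + t = m + 2 → ∀ v ∈ singularSubmodule (Fin (n + 1)) (a : ℂ) (m + 1),
        (∀ i, coeff (Finsupp.single i (m + 1)) v = 0) → ∀ l, k ≤ l → zcoeff l v = 0 := by
      intro t
      induction t with
      | zero =>
        intro k hk v hv _ l hl
        ext e
        rw [coeff_zcoeff, coeff_zero]
        apply (mem_singularSubmodule.1 hv).1.coeff_eq_zero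
        rw [Finsupp.degree_eq_sum, Fin.sum_univ_succ, Finsupp.cons_zero]
        omega
      | succ t iht =>
        intro k hk v hv hval l hl
        rcases hl.lt_or_eq with hl | rfl
        · exact iht (k + 1) (by omega) v hv hval l hl
        have hv' := mem_singularSubmodule.1 hv
        rcases (show k = m + 1 ∨ k ≤ m by omega) with rfl | hkm
        · ext e
          rw [coeff_zcoeff, coeff_zero]
          by_cases he : e = 0
          · have : (Finsupp.cons (m + 1) e : Fin (n + 1) →₀ ℕ) = Finsupp.single 0 (m + 1) := by
              ext i
              refine Fin.cases ?_ (fun i => ?_) i <;> simp [he]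
            rw [this]
            exact hval 0
          · apply hv'.1.coeff_eq_zero
            rw [Finsupp.degree_eq_sum, Fin.sum_univ_succ, Finsupp.cons_zero]
            simp only [Finsupp.cons_succ]
            intro h
            apply he
            ext i
            exact Finset.sum_eq_zero_iff.1 (by omega : ∑ i, e i = 0) i (Finset.mem_univ _)
        · have hmem : zcoeff k v ∈ singularSubmodule (Fin n) (a : ℂ) (m - k + 1) := by
            rw [mem_singularSubmodule]
            refine ⟨hv'.1.finSuccEquiv_coeff_isHomogeneous k _ (by omega),
              dunkl_zcoeff hv'.2 (fun l hl => iht (k + 1) (by omega) v hv hval l hl)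
                fun j l hl => iht (k + 1) (by omega) _ (rename_mem_singularSubmodule hv _)
                  (fun i => ?_) l hl⟩
            rw [coeff_rename_perm]
            exact hval _
          rw [ih] at hmem
          exact hmem
    have h0 := key (m + 2) 0 (by omega) v hv hval
    apply (finSuccEquiv ℂ n).injective
    rw [map_zero]
    ext1 k
    rw [← zcoeff_apply, h0 k (Nat.zero_le _), Polynomial.coeff_zero]

end NoSingular

section Separation

variable {ι : Type*} [DecidableEq ι] [Fintype ι]

theorem isHomogeneous_dunkl_monomial (c : ℂ) (i : ι) (m : ℕ) :
    ∀ (e : ι →₀ ℕ) (r : ℂ), e.degree = m + 1 → (dunkl c i (monomial e r)).IsHomogeneous m := by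
  have hstep : ∀ (e : ι →₀ ℕ) (k : ι) (r : ℂ),
      (X k * dunkl c i (monomial e r)).IsHomogeneous e.degree →
      (dunkl c i (X k * monomial e r)).IsHomogeneous e.degree := by
    intro e k r h
    have h1 : ∀ σ : Equiv.Perm ι, (rename σ (monomial e r)).IsHomogeneous e.degree :=
      fun σ => (isHomogeneous_monomial r rfl).rename_isHomogeneous
    rcases eq_or_ne i k with rfl | hik
    · rw [dunkl_X_mul_self]
      exact (h.add (isHomogeneous_monomial r rfl)).sub
        ((homogeneousSubmodule ι ℂ e.degree).smul_mem c (IsHomogeneous.sum _ _ _ fun l _ => h1 _))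
    · rw [dunkl_X_mul_of_ne c hik]
      exact h.add ((homogeneousSubmodule ι ℂ e.degree).smul_mem c (h1 _))
  have hX : ∀ (e : ι →₀ ℕ) (r : ℂ), e ≠ 0 → ∃ (k : ι) (e' : ι →₀ ℕ),
      monomial e r = X k * monomial e' r ∧ e.degree = e'.degree + 1 := by
    intro e r he
    obtain ⟨k, hk⟩ := Finsupp.ne_iff.1 he
    obtain ⟨e', rfl⟩ := le_iff_exists_add.1
      (Finsupp.single_le_iff.2 (Nat.one_le_iff_ne_zero.2 hk) : Finsupp.single k 1 ≤ e)
    refine ⟨k, e', ?_, ?_⟩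
    · rw [X, monomial_mul, one_mul]
    · rw [map_add, Finsupp.degree_single, add_comm]
  induction m with
  | zero =>
    intro e r he
    obtain ⟨k, e', h1, h2⟩ := hX e r (by rintro rfl; simp at he)
    have h3 : e' = 0 := Finsupp.degree_eq_zero_iff _ |>.1 (by omega)
    have := hstep e' k r (by
      rw [h3, show monomial (0 : ι →₀ ℕ) r = C r from rfl, dunkl_C, mul_zero]
      exact isHomogeneous_zero _ _ _)
    rw [h1]
    rwa [show e'.degree = 0 by omega] at this
  | succ m ih =>
    intro e r he
    obtain ⟨k, e', h1, h2⟩ := hX e r (by rintro rfl; simp at he)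
    have h3 : e'.degree = m + 1 := by omega
    rw [h1, ← h3]
    refine hstep e' k r ?_
    rw [h3, add_comm]
    exact (isHomogeneous_X ℂ k).mul (ih e' r h3)

theorem homogeneousComponent_dunkl (c : ℂ) (i : ι) (m : ℕ) (p : MvPolynomial ι ℂ) :
    homogeneousComponent m (dunkl c i p) = dunkl c i (homogeneousComponent (m + 1) p) := by
  induction p using MvPolynomial.monomial_add_induction_on with
  | C r => 
    rw [dunkl_C, map_zero, homogeneousComponent_of_mem (isHomogeneous_C ι r), if_neg (by omega),
      map_zero]
  | monomial_add e r p _ _ hp =>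
    rw [map_add, map_add, map_add, map_add, hp]
    congr 1
    rw [homogeneousComponent_of_mem (isHomogeneous_monomial r rfl)]
    rcases Nat.eq_zero_or_eq_succ_pred e.degree with h | h
    · rw [if_neg (by omega), (Finsupp.degree_eq_zero_iff e).1 h,
        show monomial (0 : ι →₀ ℕ) r = C r from rfl, dunkl_C, map_zero, map_zero]
    · rw [homogeneousComponent_of_mem (isHomogeneous_dunkl_monomial c i _ e r h)]
      by_cases hm : e.degree = m + 1
      · rw [if_pos (by rw [hm]; rfl), if_pos hm.symm]
      · rw [if_neg (fun h' => hm (by rw [h, h'])), if_neg (fun h' => hm h'.symm), map_zero]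

theorem exists_eval_dunklPoly_ne_zero (a n N : ℕ) :
    ∀ F : MvPolynomial (Fin n) ℂ, F ≠ 0 → (∀ k, N ≤ k → homogeneousComponent k F = 0) →
      ∃ q, eval 0 (dunklPoly (a : ℂ) q F) ≠ 0 := by
  induction N with
  | zero =>
    intro F hF h
    refine absurd ?_ hF
    rw [← sum_homogeneousComponent F]
    exact Finset.sum_eq_zero fun k _ => h k (Nat.zero_le k)
  | succ N ih =>
    intro F hF h
    by_cases hD : ∀ i, dunkl (a : ℂ) i F = 0
    · refine ⟨1, ?_⟩
      have h0 : ∀ m, homogeneousComponent (m + 1) F = 0 := by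
        intro m
        have : homogeneousComponent (m + 1) F ∈ singularSubmodule (Fin n) (a : ℂ) (m + 1) := by
          rw [mem_singularSubmodule]
          refine ⟨homogeneousComponent_isHomogeneous _ _, fun i => ?_⟩
          rw [← homogeneousComponent_dunkl, hD, map_zero]
        rwa [singularSubmodule_fin_eq_bot, Submodule.mem_bot] at this
      have h1 : F = C (coeff 0 F) := by
        conv_lhs => rw [← sum_homogeneousComponent F]
        rw [Finset.sum_range_succ', Finset.sum_eq_zero fun k _ => h0 k, zero_add,
          homogeneousComponent_zero]
      rw [map_one, Module.End.one_apply, h1, eval_C]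
      intro h2
      rw [h2, C_0] at h1
      exact hF h1
    · push Not at hD
      obtain ⟨i, hi⟩ := hD
      obtain ⟨q, hq⟩ := ih _ hi fun k hk => by
        rw [homogeneousComponent_dunkl, h _ (by omega), map_zero]
      refine ⟨q * X i, ?_⟩
      rwa [map_mul (dunklPoly _), dunklPoly_X, Module.End.mul_apply]

/-- The functionals `F ↦ (x F)(0)`, for `x` in the algebra generated by `dunklT` and `dunklL`,
separate symmetric polynomials. -/
theorem exists_eval_dunklAlg_ne_zero (a : ℕ) {n : ℕ} {F : MvPolynomial (Fin n) ℂ}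
    (hF : F.IsSymmetric) (hF0 : F ≠ 0) :
    ∃ x ∈ dunklAlg (Fin n) (a : ℂ), eval 0 (x F) ≠ 0 := by
  obtain ⟨q, hq⟩ := exists_eval_dunklPoly_ne_zero a n (F.totalDegree + 1) F hF0 fun k hk =>
    homogeneousComponent_eq_zero _ _ (by omega)
  let qs := ∑ σ : Equiv.Perm (Fin n), rename σ q
  have hqs : qs.IsSymmetric := by
    intro τ
    simp only [qs, map_sum, rename_rename]
    exact Fintype.sum_equiv (Equiv.mulLeft τ) _ _ fun σ => rfl
  refine ⟨dunklPoly a qs, dunklPoly_mem_dunklAlg _ hqs, ?_⟩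
  have h1 : ∀ σ : Equiv.Perm (Fin n), eval 0 (dunklPoly (a : ℂ) (rename σ q) F) =
      eval 0 (dunklPoly (a : ℂ) q F) := by
    intro σ
    have := rename_dunklPoly (a : ℂ) σ q F
    rw [hF σ] at this
    rw [← this, eval_rename]
    rfl
  simp only [qs, map_sum, LinearMap.sum_apply, h1]
  rw [Finset.sum_const, nsmul_eq_mul]
  refine mul_ne_zero ?_ hq
  simp [Nat.factorial_ne_zero, Fintype.card_perm]

end Separation

section Kernel

/-- `∏ j, (t - y_j)` as a polynomial in `t`. -/
noncomputable def rootPoly (b : ℕ) : Polynomial (MvPolynomial (Fin b) ℂ) :=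
  ∏ j, (Polynomial.X - Polynomial.C (X j))

/-- The coefficient of `t^k` in `∏ j, (t - y_j)^a`. -/
noncomputable def rootCoeff (a b k : ℕ) : MvPolynomial (Fin b) ℂ := (rootPoly b ^ a).coeff k

theorem natDegree_rootPoly (b : ℕ) : (rootPoly b).natDegree = b := by
  rw [rootPoly, Polynomial.natDegree_prod_of_monic _ _ fun j _ => Polynomial.monic_X_sub_C _]
  simp

theorem natDegree_rootPoly_pow_lt (a b : ℕ) : (rootPoly b ^ a).natDegree < a * b + 1 := by
  refine Nat.lt_succ_of_le (Polynomial.natDegree_pow_le.trans ?_)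
  rw [natDegree_rootPoly]

/-- `∏ (x_i - y_j)^a` as a polynomial in `x`. -/
noncomputable def kernelX (a n b : ℕ) (y : Fin b → ℂ) : MvPolynomial (Fin n) ℂ :=
  ∏ i, ∏ j, (X i - C (y j)) ^ a

/-- `∏ (x_i - y_j)^a` as a polynomial in `y`. -/
noncomputable def kernelY (a n b : ℕ) (x : Fin n → ℂ) : MvPolynomial (Fin b) ℂ :=
  ∏ i, ∏ j, (C (x i) - X j) ^ a

theorem eval_kernelX (a n b : ℕ) (x : Fin n → ℂ) (y : Fin b → ℂ) :
    eval x (kernelX a n b y) = ∏ i, ∏ j, (x i - y j) ^ a := by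
  simp [kernelX]

theorem eval_kernelY (a n b : ℕ) (x : Fin n → ℂ) (y : Fin b → ℂ) :
    eval y (kernelY a n b x) = ∏ i, ∏ j, (x i - y j) ^ a := by
  simp [kernelY]

theorem kernelX_eq_sum (a n b : ℕ) (y : Fin b → ℂ) :
    kernelX a n b y = ∑ κ : Fin n → Fin (a * b + 1),
      (∏ i, eval y (rootCoeff a b (κ i))) • ∏ i, X i ^ (κ i : ℕ) := by
  have h : ∀ i : Fin n, ∏ j, (X i - C (y j) : MvPolynomial (Fin n) ℂ) ^ a =
      ∑ k : Fin (a * b + 1), C (eval y (rootCoeff a b k)) * X i ^ (k : ℕ) := by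
    intro i
    have := Polynomial.eval₂_eq_sum_range' ((C : ℂ →+* MvPolynomial (Fin n) ℂ).comp (eval y))
      (natDegree_rootPoly_pow_lt a b) (X i)
    rw [Finset.sum_range] at this
    simp only [rootCoeff]
    refine Eq.trans ?_ this
    rw [Polynomial.eval₂_pow, rootPoly, Polynomial.eval₂_finsetProd, Finset.prod_pow]
    simp
  simp only [kernelX, h]
  rw [Fintype.prod_sum]
  refine Finset.sum_congr rfl fun κ _ => ?_
  rw [Finset.prod_mul_distrib, smul_eq_C_mul, map_prod]

theorem kernelY_eq_sum (a n b : ℕ) (x : Fin n → ℂ) :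
    kernelY a n b x = ∑ κ : Fin n → Fin (a * b + 1),
      (∏ i, x i ^ (κ i : ℕ)) • ∏ i, rootCoeff a b (κ i) := by
  have h : ∀ i : Fin n, ∏ j, (C (x i) - X j : MvPolynomial (Fin b) ℂ) ^ a =
      ∑ k : Fin (a * b + 1), C (x i ^ (k : ℕ)) * rootCoeff a b k := by
    intro i
    have := Polynomial.eval_eq_sum_range' (natDegree_rootPoly_pow_lt a b) (C (x i))
    rw [Finset.sum_range] at this
    simp only [rootCoeff, C_pow]
    refine Eq.trans ?_ (this.trans (Finset.sum_congr rfl fun k _ => mul_comm _ _))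
    rw [Polynomial.eval_pow, rootPoly, Polynomial.eval_prod, Finset.prod_pow]
    simp
  simp only [kernelY, h]
  rw [Fintype.prod_sum]
  refine Finset.sum_congr rfl fun κ _ => ?_
  rw [Finset.prod_mul_distrib, smul_eq_C_mul, map_prod]

/-- Apply a functional in the variables `x` to the kernel `∏ (x_i - y_j)^a`. -/
noncomputable def kernelMap (a n b : ℕ) :
    Module.Dual ℂ (MvPolynomial (Fin n) ℂ) →ₗ[ℂ] MvPolynomial (Fin b) ℂ :=
  ∑ κ : Fin n → Fin (a * b + 1),
    (LinearMap.toSpanSingleton ℂ _ (∏ i, rootCoeff a b (κ i))) ∘ₗ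
      Module.Dual.eval ℂ _ (∏ i, X i ^ (κ i : ℕ))

theorem kernelMap_apply (a n b : ℕ) (φ : Module.Dual ℂ (MvPolynomial (Fin n) ℂ)) :
    kernelMap a n b φ = ∑ κ : Fin n → Fin (a * b + 1),
      φ (∏ i, X i ^ (κ i : ℕ)) • ∏ i, rootCoeff a b (κ i) := by
  simp [kernelMap]

theorem eval_kernelMap (a n b : ℕ) (φ : Module.Dual ℂ (MvPolynomial (Fin n) ℂ))
    (y : Fin b → ℂ) : eval y (kernelMap a n b φ) = φ (kernelX a n b y) := by
  rw [kernelMap_apply, kernelX_eq_sum, map_sum, map_sum]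
  refine Finset.sum_congr rfl fun κ _ => ?_
  rw [smul_eval, map_smul, map_prod (eval y), smul_eq_mul, mul_comm]

theorem eq_zero_of_eval_ne {σ : Type*} {P Q : MvPolynomial σ ℂ} (hQ : Q ≠ 0)
    (h : ∀ x, eval x Q ≠ 0 → eval x P = 0) : P = 0 := by
  have : Q * P = 0 := by
    apply MvPolynomial.funext
    intro x
    rw [map_mul, map_zero]
    by_cases hx : eval x Q = 0
    · rw [hx, zero_mul]
    · rw [h x hx, mul_zero]
  exact (mul_eq_zero.1 this).resolve_left hQ

theorem eq_zero_of_generic {n : ℕ} {P : MvPolynomial (Fin n) ℂ} (S : Finset ℂ)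
    (h : ∀ x : Fin n → ℂ, Function.Injective x → (∀ i, x i ∉ S) → eval x P = 0) : P = 0 := by
  refine eq_zero_of_eval_ne (Q := (∏ i, ∏ j ∈ Finset.univ.erase i, (X i - X j)) *
    ∏ i, ∏ s ∈ S, (X i - C s)) ?_ fun x hx => h x ?_ ?_
  · refine mul_ne_zero (Finset.prod_ne_zero_iff.2 fun i _ => Finset.prod_ne_zero_iff.2 fun j hj =>
      X_sub_X_ne_zero (Finset.ne_of_mem_erase hj).symm)
      (Finset.prod_ne_zero_iff.2 fun i _ => Finset.prod_ne_zero_iff.2 fun s _ hs => ?_)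
    have := congrArg (eval fun _ => s + 1) hs
    simp at this
  · intro i j hij
    by_contra hne
    apply hx
    rw [map_mul, map_prod, Finset.prod_eq_zero (Finset.mem_univ i), zero_mul]
    rw [map_prod]
    exact Finset.prod_eq_zero (Finset.mem_erase.2 ⟨Ne.symm hne, Finset.mem_univ j⟩) (by simp [hij])
  · intro i hi
    apply hx
    rw [map_mul, mul_eq_zero]
    right
    rw [map_prod]
    refine Finset.prod_eq_zero (Finset.mem_univ i) ?_
    rw [map_prod]
    exact Finset.prod_eq_zero hi (by simp)

theorem kernelMap_comp {a n b : ℕ} {A : Module.End ℂ (MvPolynomial (Fin n) ℂ)}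
    {B : Module.End ℂ (MvPolynomial (Fin b) ℂ)}
    (h : ∀ (x : Fin n → ℂ) (y : Fin b → ℂ), Function.Injective x → Function.Injective y →
      (∀ i j, x i ≠ y j) → eval x (A (kernelX a n b y)) = eval y (B (kernelY a n b x)))
    (φ : Module.Dual ℂ (MvPolynomial (Fin n) ℂ)) :
    kernelMap a n b (φ ∘ₗ A) = B (kernelMap a n b φ) := by
  rw [← sub_eq_zero]
  refine eq_zero_of_generic ∅ fun y hy _ => ?_
  have key : A (kernelX a n b y) = ∑ κ : Fin n → Fin (a * b + 1),
      eval y (B (∏ i, rootCoeff a b (κ i))) • ∏ i, X i ^ (κ i : ℕ) := by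
    rw [← sub_eq_zero]
    refine eq_zero_of_generic (Finset.univ.image y) fun x hx hxy => ?_
    rw [map_sub, h x y hx hy fun i j e => hxy i (e ▸ Finset.mem_image_of_mem y (Finset.mem_univ j)),
      kernelY_eq_sum, map_sum, map_sum, map_sum, sub_eq_zero]
    refine Finset.sum_congr rfl fun κ _ => ?_
    rw [map_smul B, smul_eval, smul_eval, mul_comm]
    simp
  rw [map_sub, eval_kernelMap, LinearMap.comp_apply, key, kernelMap_apply, map_sum, map_sum,
    map_sum, sub_eq_zero]
  refine Finset.sum_congr rfl fun κ _ => ?_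
  rw [map_smul φ, map_smul B, smul_eval, smul_eq_mul, mul_comm]

theorem eval_derivation_prod {A : Type*} [CommRing A] [Algebra ℂ A] (D : Derivation ℂ A A)
    (ev : A →+* ℂ) {s : Type*} [DecidableEq s] (S : Finset s) (f : s → A) (ρ : s → ℂ)
    (h : ∀ i, ev (D (f i)) = ev (f i) * ρ i) (hD : ∀ i, D (D (f i)) = 0) :
    ev (D (∏ i ∈ S, f i)) = ev (∏ i ∈ S, f i) * ∑ i ∈ S, ρ i ∧
    ev (D (D (∏ i ∈ S, f i))) =
      ev (∏ i ∈ S, f i) * ((∑ i ∈ S, ρ i) ^ 2 - ∑ i ∈ S, ρ i ^ 2) := by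
  induction S using Finset.induction_on with
  | empty => simp
  | insert i S hi ih =>
    obtain ⟨h1, h2⟩ := ih
    rw [Finset.prod_insert hi, Finset.sum_insert hi, Finset.sum_insert hi]
    simp only [Derivation.leibniz, map_add, smul_eq_mul, map_mul, h1, h2, h, hD, mul_zero, map_zero]
    constructor <;> ring

end Kernel

section KernelIdentities

theorem dunkl_of_isSymmetric {ι : Type*} [DecidableEq ι] [Fintype ι] (c : ℂ)
    {F : MvPolynomial ι ℂ} (hF : F.IsSymmetric) (i : ι) : dunkl c i F = pderiv i F := by
  rw [dunkl_apply, Finset.sum_eq_zero fun j _ => divDiff_eq_zero (hF _), smul_zero, sub_zero]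

theorem eval_dunklT_of_isSymmetric {ι : Type*} [DecidableEq ι] [Fintype ι] (c : ℂ)
    {F : MvPolynomial ι ℂ} (hF : F.IsSymmetric) (x : ι → ℂ) :
    eval x (dunklT c F) = ∑ i, eval x (pderiv i F) := by
  rw [dunklT_apply, map_sum]
  simp only [dunkl_of_isSymmetric c hF]

theorem eval_dunklL_of_isSymmetric {ι : Type*} [DecidableEq ι] [Fintype ι] (c : ℂ)
    {F : MvPolynomial ι ℂ} (hF : F.IsSymmetric) {x : ι → ℂ} (hx : Function.Injective x) :
    eval x (dunklL c F) = ∑ i, x i * (eval x (pderiv i (pderiv i F)) -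
      c * ∑ l, (eval x (pderiv i F) - eval x (pderiv l F)) / (x i - x l)) := by
  rw [dunklL_apply, map_sum]
  refine Finset.sum_congr rfl fun i _ => ?_
  rw [map_mul, eval_X, dunkl_of_isSymmetric c hF, dunkl_apply, map_sub, smul_eval, map_sum]
  congr 3
  refine Finset.sum_congr rfl fun l _ => ?_
  rcases eq_or_ne i l with rfl | h
  · simp
  · rw [eval_divDiff _ (hx.ne h), rename_pderiv, hF, Equiv.swap_apply_left]

variable {a n b : ℕ}

theorem kernelX_isSymmetric (y : Fin b → ℂ) : (kernelX a n b y).IsSymmetric := by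
  intro σ
  simp only [kernelX, map_prod, map_pow, map_sub, rename_X, rename_C]
  exact Equiv.prod_comp σ fun i => ∏ j, (X i - C (y j)) ^ a

theorem kernelY_isSymmetric (x : Fin n → ℂ) : (kernelY a n b x).IsSymmetric := by
  intro σ
  simp only [kernelY, map_prod, map_pow, map_sub, rename_X, rename_C]
  exact Finset.prod_congr rfl fun i _ => Equiv.prod_comp σ fun j => (C (x i) - X j) ^ a

theorem eval_pderiv_kernelX {x : Fin n → ℂ} {y : Fin b → ℂ} (h : ∀ i j, x i ≠ y j) (i₀ : Fin n) :
    eval x (pderiv i₀ (kernelX a n b y)) =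
      (∏ i, ∏ j, (x i - y j) ^ a) * (a * ∑ j, (x i₀ - y j)⁻¹) ∧
    eval x (pderiv i₀ (pderiv i₀ (kernelX a n b y))) =
      (∏ i, ∏ j, (x i - y j) ^ a) *
        ((a * ∑ j, (x i₀ - y j)⁻¹) ^ 2 - a * ∑ j, (x i₀ - y j)⁻¹ ^ 2) := by
  have hk : kernelX a n b y = ∏ s : (Fin n × Fin b) × Fin a, (X s.1.1 - C (y s.1.2)) := by
    simp only [kernelX, Fintype.prod_prod_type, Finset.prod_const, Finset.card_univ,
      Fintype.card_fin]
  have := eval_derivation_prod (pderiv i₀) (eval x) Finset.univ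
    (fun s : (Fin n × Fin b) × Fin a => (X s.1.1 - C (y s.1.2) : MvPolynomial (Fin n) ℂ))
    (fun s => if s.1.1 = i₀ then (x i₀ - y s.1.2)⁻¹ else 0) (fun s => by
      rw [map_sub, pderiv_C, sub_zero]
      split_ifs with hs
      · have := sub_ne_zero.2 (h i₀ s.1.2)
        rw [hs, pderiv_X_self]
        simp [this]
      · rw [pderiv_X_of_ne hs]
        simp) (fun s => by
      rw [map_sub, pderiv_C, sub_zero]
      by_cases hs : s.1.1 = i₀
      · rw [hs, pderiv_X_self, pderiv_one]
      · rw [pderiv_X_of_ne hs, map_zero])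
  rw [← hk, eval_kernelX] at this
  convert this using 3
  · simp [Fintype.sum_prod_type, ← Finset.mul_sum, Finset.sum_ite_irrel]
  · congr 1
    · simp [Fintype.sum_prod_type, ← Finset.mul_sum, Finset.sum_ite_irrel]
    · simp [Fintype.sum_prod_type, ← Finset.mul_sum, Finset.sum_ite_irrel, ite_pow]

theorem eval_pderiv_kernelY {x : Fin n → ℂ} {y : Fin b → ℂ} (h : ∀ i j, x i ≠ y j) (j₀ : Fin b) :
    eval y (pderiv j₀ (kernelY a n b x)) =
      (∏ i, ∏ j, (x i - y j) ^ a) * -(a * ∑ i, (x i - y j₀)⁻¹) ∧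
    eval y (pderiv j₀ (pderiv j₀ (kernelY a n b x))) =
      (∏ i, ∏ j, (x i - y j) ^ a) *
        ((a * ∑ i, (x i - y j₀)⁻¹) ^ 2 - a * ∑ i, (x i - y j₀)⁻¹ ^ 2) := by
  have hk : kernelY a n b x = ∏ s : (Fin n × Fin b) × Fin a, (C (x s.1.1) - X s.1.2) := by
    simp only [kernelY, Fintype.prod_prod_type, Finset.prod_const, Finset.card_univ,
      Fintype.card_fin]
  have := eval_derivation_prod (pderiv j₀) (eval y) Finset.univ
    (fun s : (Fin n × Fin b) × Fin a => (C (x s.1.1) - X s.1.2 : MvPolynomial (Fin b) ℂ))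
    (fun s => if s.1.2 = j₀ then -(x s.1.1 - y j₀)⁻¹ else 0) (fun s => by
      rw [map_sub, pderiv_C, zero_sub]
      split_ifs with hs
      · have := sub_ne_zero.2 (h s.1.1 j₀)
        rw [hs, pderiv_X_self]
        simp [this]
      · rw [pderiv_X_of_ne hs]
        simp) (fun s => by
      rw [map_sub, pderiv_C, zero_sub, map_neg]
      by_cases hs : s.1.2 = j₀
      · rw [hs, pderiv_X_self, pderiv_one, neg_zero]
      · rw [pderiv_X_of_ne hs, map_zero, neg_zero])
  rw [← hk, eval_kernelY] at this
  convert this using 3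
  · simp [Fintype.sum_prod_type, Finset.mul_sum]
  · congr 1
    · rw [← neg_sq]
      simp [Fintype.sum_prod_type, Finset.mul_sum]
    · simp [Fintype.sum_prod_type, Finset.mul_sum, ite_pow]

theorem eval_dunklT_kernel {x : Fin n → ℂ} {y : Fin b → ℂ} (h : ∀ i j, x i ≠ y j) :
    eval x (dunklT (a : ℂ) (kernelX a n b y)) = -eval y (dunklT (a : ℂ) (kernelY a n b x)) := by
  rw [eval_dunklT_of_isSymmetric _ (kernelX_isSymmetric y),
    eval_dunklT_of_isSymmetric _ (kernelY_isSymmetric x)]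
  simp only [(eval_pderiv_kernelX h _).1, (eval_pderiv_kernelY h _).1]
  rw [← Finset.mul_sum, ← Finset.mul_sum, ← Finset.mul_sum, Finset.sum_neg_distrib,
    ← Finset.mul_sum, Finset.sum_comm]
  ring

theorem sum_mul_inv_identity {x : Fin n → ℂ} {y : Fin b → ℂ} (r : Fin n → Fin b → ℂ)
    (hr : ∀ i j, (x i - y j) * r i j = 1) :
    (∑ i, x i * ((∑ j, r i j) ^ 2 + ∑ l, ∑ j, r i j * r l j)) -
      ∑ j, y j * ((∑ i, r i j) ^ 2 + ∑ m, ∑ i, r i j * r i m) =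
      (b + n) * ∑ i, ∑ j, r i j := by
  have h1 : (∑ i, x i * (∑ j, r i j) ^ 2) - ∑ j, y j * ∑ m, ∑ i, r i j * r i m =
      b * ∑ i, ∑ j, r i j := by
    have e1 : ∑ i, x i * (∑ j, r i j) ^ 2 = ∑ i, ∑ j, ∑ m, x i * (r i j * r i m) := by
      refine Finset.sum_congr rfl fun i _ => ?_
      rw [sq, Finset.sum_mul_sum, Finset.mul_sum]
      simp only [Finset.mul_sum]
    have e2 : ∑ j, y j * ∑ m, ∑ i, r i j * r i m = ∑ i, ∑ j, ∑ m, y j * (r i j * r i m) := by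
      simp only [Finset.mul_sum]
      rw [Finset.sum_comm]
      conv_rhs => rw [Finset.sum_comm]
      rw [Finset.sum_comm]
      exact Finset.sum_congr rfl fun j _ => Finset.sum_comm
    rw [e1, e2]
    simp only [← Finset.sum_sub_distrib]
    have e3 : ∀ i j m, x i * (r i j * r i m) - y j * (r i j * r i m) = r i m := fun i j m => by
      linear_combination r i m * hr i j
    simp only [e3, Finset.sum_const, Finset.card_univ, Fintype.card_fin, nsmul_eq_mul,
      ← Finset.mul_sum]
  have h2 : (∑ i, x i * ∑ l, ∑ j, r i j * r l j) - ∑ j, y j * (∑ i, r i j) ^ 2 =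
      n * ∑ i, ∑ j, r i j := by
    have e1 : ∑ j, y j * (∑ i, r i j) ^ 2 = ∑ i, ∑ l, ∑ j, y j * (r i j * r l j) := by
      have : ∑ j, y j * (∑ i, r i j) ^ 2 = ∑ j, ∑ i, ∑ l, y j * (r i j * r l j) := by
        refine Finset.sum_congr rfl fun j _ => ?_
        rw [sq, Finset.sum_mul_sum, Finset.mul_sum]
        simp only [Finset.mul_sum]
      rw [this, Finset.sum_comm]
      exact Finset.sum_congr rfl fun i _ => Finset.sum_comm
    rw [e1]
    simp only [Finset.mul_sum, ← Finset.sum_sub_distrib]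
    have e3 : ∀ i l j, x i * (r i j * r l j) - y j * (r i j * r l j) = r l j := fun i l j => by
      linear_combination r l j * hr i j
    simp only [e3, Finset.sum_const, Finset.card_univ, Fintype.card_fin, nsmul_eq_mul]
    simp only [Finset.mul_sum]
  simp only [mul_add, Finset.sum_add_distrib]
  linear_combination h1 + h2

theorem eval_dunklL_kernel {x : Fin n → ℂ} {y : Fin b → ℂ} (hx : Function.Injective x)
    (hy : Function.Injective y) (h : ∀ i j, x i ≠ y j) :
    eval x (dunklL (a : ℂ) (kernelX a n b y)) = eval y (dunklL (a : ℂ) (kernelY a n b x)) +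
      (a * (b + n) - 1 - a) * eval x (dunklT (a : ℂ) (kernelX a n b y)) := by
  rw [eval_dunklL_of_isSymmetric _ (kernelX_isSymmetric y) hx,
    eval_dunklL_of_isSymmetric _ (kernelY_isSymmetric x) hy,
    eval_dunklT_of_isSymmetric _ (kernelX_isSymmetric y)]
  simp only [(eval_pderiv_kernelX h _).1, (eval_pderiv_kernelY h _).1,
    (eval_pderiv_kernelX h _).2, (eval_pderiv_kernelY h _).2]
  set E := ∏ i, ∏ j, (x i - y j) ^ a
  set r : Fin n → Fin b → ℂ := fun i j => (x i - y j)⁻¹ with hrdef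
  have hr : ∀ i j, (x i - y j) * r i j = 1 := fun i j => mul_inv_cancel₀ (sub_ne_zero.2 (h i j))
  have hA : ∀ i, ∑ l, (E * (a * ∑ j, r i j) - E * (a * ∑ j, r l j)) / (x i - x l) =
      -(E * a * ((∑ l, ∑ j, r i j * r l j) - ∑ j, r i j ^ 2)) := by
    intro i
    have e : ∀ l, (E * (a * ∑ j, r i j) - E * (a * ∑ j, r l j)) / (x i - x l) =
        -(E * a * ((∑ j, r i j * r l j) - if l = i then ∑ j, r i j ^ 2 else 0)) := by
      intro l
      split_ifs with hl
      · subst hl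
        simp [sq]
      · rw [sub_zero, div_eq_iff (sub_ne_zero.2 (hx.ne (Ne.symm hl))), ← mul_sub, ← mul_sub,
          ← Finset.sum_sub_distrib]
        have e' : ∀ j, r i j - r l j = - ((r i j * r l j) * (x i - x l)) := fun j => by
          linear_combination r l j * hr i j - r i j * hr l j
        simp only [e', Finset.sum_neg_distrib, ← Finset.sum_mul]
        ring
    simp only [e, Finset.sum_neg_distrib, ← Finset.mul_sum, Finset.sum_sub_distrib,
      Finset.sum_ite_eq', Finset.mem_univ, if_true]
  have hB : ∀ j, ∑ m, (E * -(a * ∑ i, r i j) - E * -(a * ∑ i, r i m)) / (y j - y m) =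
      -(E * a * ((∑ m, ∑ i, r i j * r i m) - ∑ i, r i j ^ 2)) := by
    intro j
    have e : ∀ m, (E * -(a * ∑ i, r i j) - E * -(a * ∑ i, r i m)) / (y j - y m) =
        -(E * a * ((∑ i, r i j * r i m) - if m = j then ∑ i, r i j ^ 2 else 0)) := by
      intro m
      split_ifs with hm
      · subst hm
        simp [sq]
      · rw [sub_zero, div_eq_iff (sub_ne_zero.2 (hy.ne (Ne.symm hm))), ← mul_sub,
          neg_sub_neg, ← mul_sub, ← Finset.sum_sub_distrib]
        have e' : ∀ i, r i m - r i j = - ((r i j * r i m) * (y j - y m)) := fun i => by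
          linear_combination r i j * hr i m - r i m * hr i j
        simp only [e', Finset.sum_neg_distrib, ← Finset.sum_mul]
        ring
    simp only [e, Finset.sum_neg_distrib, ← Finset.mul_sum, Finset.sum_sub_distrib,
      Finset.sum_ite_eq', Finset.mem_univ, if_true]
  have hrs : ∀ i j, (x i - y j)⁻¹ = r i j := fun i j => rfl
  simp only [hrs, hA, hB]
  have key := sum_mul_inv_identity r hr
  have hsq : (∑ i, x i * ∑ j, r i j ^ 2) - ∑ j, y j * ∑ i, r i j ^ 2 = ∑ i, ∑ j, r i j := by
    simp only [Finset.mul_sum]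
    rw [Finset.sum_comm (f := fun j i => y j * r i j ^ 2)]
    simp only [← Finset.sum_sub_distrib]
    refine Finset.sum_congr rfl fun i _ => Finset.sum_congr rfl fun j _ => ?_
    linear_combination r i j * hr i j
  have hX : ∑ i, x i * (E * ((a * ∑ j, r i j) ^ 2 - a * ∑ j, r i j ^ 2) -
      a * -(E * a * ((∑ l, ∑ j, r i j * r l j) - ∑ j, r i j ^ 2))) =
      E * a ^ 2 * (∑ i, x i * ((∑ j, r i j) ^ 2 + ∑ l, ∑ j, r i j * r l j)) -
      E * (a + a ^ 2) * ∑ i, x i * ∑ j, r i j ^ 2 := by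
    rw [Finset.mul_sum, Finset.mul_sum, ← Finset.sum_sub_distrib]
    exact Finset.sum_congr rfl fun i _ => by ring
  have hY : ∑ j, y j * (E * ((a * ∑ i, r i j) ^ 2 - a * ∑ i, r i j ^ 2) -
      a * -(E * a * ((∑ m, ∑ i, r i j * r i m) - ∑ i, r i j ^ 2))) =
      E * a ^ 2 * (∑ j, y j * ((∑ i, r i j) ^ 2 + ∑ m, ∑ i, r i j * r i m)) -
      E * (a + a ^ 2) * ∑ j, y j * ∑ i, r i j ^ 2 := by
    rw [Finset.mul_sum, Finset.mul_sum, ← Finset.sum_sub_distrib]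
    exact Finset.sum_congr rfl fun i _ => by ring
  rw [hX, hY, ← Finset.mul_sum, ← Finset.mul_sum]
  linear_combination E * a ^ 2 * key - E * (a + a ^ 2) * hsq

theorem kernelMap_comp_dunklT (φ : Module.Dual ℂ (MvPolynomial (Fin n) ℂ)) :
    kernelMap a n b (φ ∘ₗ dunklT (a : ℂ)) = -dunklT (a : ℂ) (kernelMap a n b φ) :=
  kernelMap_comp (B := -dunklT (a : ℂ)) (fun x y _ _ h => by
    rw [eval_dunklT_kernel h, LinearMap.neg_apply, map_neg]) φ

theorem kernelMap_comp_dunklL (φ : Module.Dual ℂ (MvPolynomial (Fin n) ℂ)) :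
    kernelMap a n b (φ ∘ₗ dunklL (a : ℂ)) = dunklL (a : ℂ) (kernelMap a n b φ) -
      ((a * (b + n) - 1 - a : ℂ)) • dunklT (a : ℂ) (kernelMap a n b φ) :=
  kernelMap_comp (B := dunklL (a : ℂ) - (a * (b + n) - 1 - a : ℂ) • dunklT (a : ℂ))
    (fun x y hx hy h => by
      rw [eval_dunklL_kernel hx hy h, eval_dunklT_kernel h, LinearMap.sub_apply,
        LinearMap.smul_apply, map_sub, smul_eval]
      ring) φ

theorem kernelMap_comp_mem {Q : Submodule ℂ (MvPolynomial (Fin b) ℂ)}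
    (hQ : ∀ x ∈ dunklAlg (Fin b) (a : ℂ), ∀ q ∈ Q, x q ∈ Q)
    {x : Module.End ℂ (MvPolynomial (Fin n) ℂ)} (hx : x ∈ dunklAlg (Fin n) (a : ℂ)) :
    ∀ φ : Module.Dual ℂ (MvPolynomial (Fin n) ℂ), kernelMap a n b φ ∈ Q →
      kernelMap a n b (φ ∘ₗ x) ∈ Q := by
  have hT : ∀ q ∈ Q, dunklT (a : ℂ) q ∈ Q :=
    hQ _ (Algebra.subset_adjoin (by simp))
  have hL : ∀ q ∈ Q, dunklL (a : ℂ) q ∈ Q :=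
    hQ _ (Algebra.subset_adjoin (by simp))
  induction hx using Algebra.adjoin_induction with
  | mem x hx =>
    intro φ hφ
    rcases hx with rfl | rfl
    · rw [kernelMap_comp_dunklT]
      exact Q.neg_mem (hT _ hφ)
    · rw [kernelMap_comp_dunklL]
      exact Q.sub_mem (hL _ hφ) (Q.smul_mem _ (hT _ hφ))
  | algebraMap r =>
    intro φ hφ
    have : φ ∘ₗ algebraMap ℂ (Module.End ℂ (MvPolynomial (Fin n) ℂ)) r = r • φ :=
      LinearMap.ext fun p => by
        rw [LinearMap.comp_apply, Module.algebraMap_end_apply, map_smul, LinearMap.smul_apply]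
    rw [this, map_smul]
    exact Q.smul_mem _ hφ
  | add x y _ _ hx hy =>
    intro φ hφ
    rw [LinearMap.comp_add, map_add]
    exact Q.add_mem (hx φ hφ) (hy φ hφ)
  | mul x y _ _ hx hy =>
    intro φ hφ
    exact hy _ (hx φ hφ)

theorem mem_range_kernelMap {x : Module.End ℂ (MvPolynomial (Fin b) ℂ)}
    (hx : x ∈ dunklAlg (Fin b) (a : ℂ)) :
    ∀ p ∈ LinearMap.range (kernelMap a n b), x p ∈ LinearMap.range (kernelMap a n b) := by
  have hT : ∀ p ∈ LinearMap.range (kernelMap a n b),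
      dunklT (a : ℂ) p ∈ LinearMap.range (kernelMap a n b) := by
    rintro _ ⟨φ, rfl⟩
    exact ⟨-(φ ∘ₗ dunklT (a : ℂ)), by rw [map_neg, kernelMap_comp_dunklT, neg_neg]⟩
  induction hx using Algebra.adjoin_induction with
  | mem x hx =>
    rcases hx with rfl | rfl
    · exact hT
    · rintro _ ⟨φ, rfl⟩
      have h1 : kernelMap a n b (φ ∘ₗ dunklL (a : ℂ)) ∈ LinearMap.range (kernelMap a n b) := ⟨_, rfl⟩
      rw [kernelMap_comp_dunklL] at h1
      have h2 := Submodule.add_mem _ h1 (Submodule.smul_mem _ (a * (b + n) - 1 - a : ℂ)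
        (hT _ ⟨φ, rfl⟩))
      rwa [sub_add_cancel] at h2
  | algebraMap r =>
    intro p hp
    rw [Module.algebraMap_end_apply]
    exact Submodule.smul_mem _ _ hp
  | add x y _ _ hx hy =>
    intro p hp
    exact Submodule.add_mem _ (hx p hp) (hy p hp)
  | mul x y _ _ hx hy =>
    intro p hp
    exact hx _ (hy p hp)

end KernelIdentities

section Dehomogenize

theorem coeff_aeval_of_isHomogeneous {R : Type*} [CommRing R] {d k : ℕ}
    {G : MvPolynomial (Fin 2) R} (hG : G.IsHomogeneous d) (hk : k ≤ d) :
    (aeval ![Polynomial.X, (1 : Polynomial R)] G).coeff k =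
      coeff (Finsupp.single (0 : Fin 2) k + Finsupp.single (1 : Fin 2) (d - k)) G := by
  rw [aeval_def, eval₂_eq', Polynomial.finsetSum_coeff]
  simp only [Fin.prod_univ_two, Matrix.cons_val_zero, Matrix.cons_val_one, one_pow, mul_one,
    Polynomial.algebraMap_apply, Algebra.algebraMap_self, RingHom.id_apply, Polynomial.coeff_C_mul,
    Polynomial.coeff_X_pow]
  rw [Finset.sum_eq_single (Finsupp.single (0 : Fin 2) k + Finsupp.single (1 : Fin 2) (d - k))]
  · simp
  · intro m hm hne
    rw [if_neg, mul_zero]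
    intro h
    apply hne
    have hd := (hG.degree_eq_sum_deg_support hm).symm
    rw [← Finsupp.degree_apply, Finsupp.degree_eq_sum, Fin.sum_univ_two] at hd
    ext i
    fin_cases i
    · simp [h]
    · simp
      omega
  · intro h
    rw [notMem_support_iff.1 h, zero_mul]

theorem isHomogeneous_genForm (b : ℕ) : (genForm b).IsHomogeneous b := by
  refine IsHomogeneous.sum _ _ _ fun i _ => ?_
  have h := ((isHomogeneous_C (Fin 2) (X i : MvPolynomial (Fin (b + 1)) ℂ)).mul
    (isHomogeneous_X_pow (0 : Fin 2) (i : ℕ))).mul (isHomogeneous_X_pow (1 : Fin 2) (b - (i : ℕ)))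
  convert h using 1
  have := i.2
  omega

/-- The generic polynomial `∑ i, u_i t^i`. -/
noncomputable def genPoly (b : ℕ) : Polynomial (MvPolynomial (Fin (b + 1)) ℂ) :=
  ∑ i : Fin (b + 1), Polynomial.C (X i) * Polynomial.X ^ (i : ℕ)

theorem coeffC_eq_coeff {a b k : ℕ} (hk : k ≤ a * b) : coeffC a b k = (genPoly b ^ a).coeff k := by
  have h : (genForm b ^ a).IsHomogeneous (a * b) := by
    rw [mul_comm]
    exact (isHomogeneous_genForm b).pow a
  rw [coeffC, ← coeff_aeval_of_isHomogeneous h hk, map_pow]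
  simp [genForm, genPoly]

theorem genPoly_pow (a b : ℕ) : genPoly b ^ a = ∑ κ : Fin a → Fin (b + 1),
    Polynomial.C (∏ l, X (κ l)) * Polynomial.X ^ (∑ l, (κ l : ℕ)) := by
  rw [← Fin.prod_const, genPoly, Fintype.prod_sum]
  simp [Finset.prod_mul_distrib, Finset.prod_pow_eq_pow_sum]

theorem coeffC_eq_sum {a b k : ℕ} (hk : k ≤ a * b) : coeffC a b k =
    ∑ κ : Fin a → Fin (b + 1), if k = ∑ l, (κ l : ℕ) then ∏ l, X (κ l) else 0 := by
  rw [coeffC_eq_coeff hk, genPoly_pow, Polynomial.finsetSum_coeff]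
  simp only [Polynomial.coeff_C_mul, Polynomial.coeff_X_pow, mul_ite, mul_one, mul_zero]

theorem isHomogeneous_coeffC {a b k : ℕ} (hk : k ≤ a * b) : (coeffC a b k).IsHomogeneous a := by
  rw [coeffC_eq_sum hk]
  refine IsHomogeneous.sum _ _ _ fun κ _ => ?_
  split_ifs
  · simpa using IsHomogeneous.prod Finset.univ (fun l => (X (κ l) : MvPolynomial (Fin (b+1)) ℂ))
      (fun _ => 1) fun l _ => isHomogeneous_X ℂ (κ l)
  · exact isHomogeneous_zero _ _ _

theorem isHomogeneous_FH {a b k : ℕ} {P : MvPolynomial (Fin (a * b + 1)) ℂ}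
    (hP : P.IsHomogeneous k) : (FH a b P).IsHomogeneous (a * k) :=
  hP.aeval _ fun j => isHomogeneous_coeffC (Nat.lt_succ_iff.1 j.2)

end Dehomogenize

section Roots

/-- Substitution of the coefficients of `∏ j, (t - y_j)` for the generic coefficients. -/
noncomputable def rootEval (b : ℕ) : MvPolynomial (Fin (b + 1)) ℂ →ₐ[ℂ] MvPolynomial (Fin b) ℂ :=
  aeval fun i => (rootPoly b).coeff i

theorem map_genPoly (b : ℕ) : (genPoly b).map (rootEval b : _ →+* _) = rootPoly b := by
  have h := (rootPoly b).as_sum_range' (b + 1) (by rw [natDegree_rootPoly]; omega)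
  rw [Finset.sum_range] at h
  rw [h, genPoly, Polynomial.map_sum]
  simp [rootEval, Polynomial.C_mul_X_pow_eq_monomial]

theorem rootEval_coeffC {a b k : ℕ} (hk : k ≤ a * b) :
    rootEval b (coeffC a b k) = rootCoeff a b k := by
  rw [coeffC_eq_coeff hk, rootCoeff, ← map_genPoly, ← Polynomial.map_pow, Polynomial.coeff_map]
  rfl

theorem rootEval_isSymmetric (b : ℕ) (q : MvPolynomial (Fin (b + 1)) ℂ) :
    (rootEval b q).IsSymmetric := by
  intro σ
  have h : (rename σ : MvPolynomial (Fin b) ℂ →ₐ[ℂ] _).comp (rootEval b) = rootEval b := by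
    ext1 i
    have hr : (rootPoly b).map ((rename σ : MvPolynomial (Fin b) ℂ →ₐ[ℂ] _) : _ →+* _) =
        rootPoly b := by
      rw [rootPoly, Polynomial.map_prod]
      simp only [Polynomial.map_sub, Polynomial.map_X, Polynomial.map_C, RingHom.coe_coe, rename_X]
      exact Equiv.prod_comp σ fun j =>
        (Polynomial.X - Polynomial.C (X j) : Polynomial (MvPolynomial (Fin b) ℂ))
    have := congrArg (fun p => p.coeff (i : ℕ)) hr
    simpa [rootEval, Polynomial.coeff_map] using this
  exact DFunLike.congr_fun h q

theorem eval_rootEval (b : ℕ) (q : MvPolynomial (Fin (b + 1)) ℂ) (x : Fin b → ℂ) :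
    eval x (rootEval b q) =
      eval (fun i => (∏ j, (Polynomial.X - Polynomial.C (x j))).coeff (i : ℕ)) q := by
  rw [rootEval, ← coe_aeval_eq_eval, ← coe_aeval_eq_eval]
  change (aeval x) (aeval _ q) = aeval _ q
  rw [← AlgHom.comp_apply, comp_aeval]
  congr 2
  funext i
  have : (rootPoly b).map (aeval x : MvPolynomial (Fin b) ℂ →ₐ[ℂ] ℂ).toRingHom =
      ∏ j, (Polynomial.X - Polynomial.C (x j)) := by
    simp [rootPoly, Polynomial.map_prod]
  rw [← this, Polynomial.coeff_map]
  rfl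

theorem eval_smul_of_isHomogeneous {σ R : Type*} [Fintype σ] [CommRing R] {k : ℕ}
    {q : MvPolynomial σ R} (hq : q.IsHomogeneous k) (c : R) (u : σ → R) :
    eval (c • u) q = c ^ k * eval u q := by
  rw [eval_eq', eval_eq', Finset.mul_sum]
  refine Finset.sum_congr rfl fun d hd => ?_
  have hd := (hq.degree_eq_sum_deg_support hd).symm
  rw [← Finsupp.degree_apply, Finsupp.degree_eq_sum] at hd
  simp only [Pi.smul_apply, smul_eq_mul, mul_pow, Finset.prod_mul_distrib,
    Finset.prod_pow_eq_pow_sum, hd]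
  ring

theorem eq_zero_of_rootEval_eq_zero {b k : ℕ} {q : MvPolynomial (Fin (b + 1)) ℂ}
    (hq : q.IsHomogeneous k) (h : rootEval b q = 0) : q = 0 := by
  refine eq_zero_of_eval_ne (Q := X (Fin.last b)) (X_ne_zero _) fun u hu => ?_
  rw [eval_X] at hu
  set p : Polynomial ℂ := ∑ i : Fin (b + 1), Polynomial.C (u i) * Polynomial.X ^ (i : ℕ)
  have hc : ∀ i : Fin (b + 1), p.coeff i = u i := by
    intro i
    simp [p, Polynomial.finsetSum_coeff, Polynomial.coeff_X_pow, Fin.val_inj]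
  have hdle : p.natDegree ≤ b := by
    refine Polynomial.natDegree_sum_le_of_forall_le _ _ fun i _ => ?_
    exact (Polynomial.natDegree_C_mul_X_pow_le _ _).trans (Nat.lt_succ_iff.1 i.2)
  have hd : p.natDegree = b := by
    refine le_antisymm hdle (Polynomial.le_natDegree_of_ne_zero ?_)
    have := hc (Fin.last b)
    rw [Fin.val_last] at this
    rwa [this]
  have hlc : p.leadingCoeff = u (Fin.last b) := by
    rw [Polynomial.leadingCoeff, hd, ← hc, Fin.val_last]
  have hs := IsAlgClosed.splits p
  have hcard : p.roots.card = b := by rw [← hd]; exact hs.natDegree_eq_card_roots.symm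
  have hp := hs.eq_prod_roots
  obtain ⟨l, hl⟩ := Quot.exists_rep p.roots
  have hll : l.length = b := by
    rw [← hcard, ← hl]; rfl
  subst hll
  have hprod : (p.roots.map fun a => Polynomial.X - Polynomial.C a).prod =
      ∏ j : Fin l.length, (Polynomial.X - Polynomial.C (l.get j)) := by
    rw [← hl]
    change ((l : Multiset ℂ).map _).prod = _
    rw [Multiset.map_coe, Multiset.prod_coe, ← List.prod_ofFn]
    congr 1
    exact (List.ofFn_getElem_eq_map l _).symm
  rw [hprod, hlc] at hp
  have he := eval_rootEval l.length q l.get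
  rw [h, map_zero] at he
  have hu' : u = u (Fin.last _) •
      fun i : Fin (l.length + 1) => (∏ j, (Polynomial.X - Polynomial.C (l.get j))).coeff (i : ℕ) := by
    funext i
    rw [Pi.smul_apply, smul_eq_mul, ← Polynomial.coeff_C_mul, ← hp, hc]
  rw [hu', eval_smul_of_isHomogeneous hq, ← he, mul_zero]

end Roots

section HomogeneousDimension

theorem finrank_homogeneousSubmodule (m k : ℕ) :
    Module.finrank ℂ (homogeneousSubmodule (Fin (m + 1)) ℂ k) = (m + k).choose m := by
  have hset : {d : Fin (m + 1) →₀ ℕ | d.degree = k} =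
      ((Finset.univ.finsuppAntidiag k : Finset (Fin (m + 1) →₀ ℕ)) : Set _) := by
    ext d
    simp [Finset.mem_finsuppAntidiag, Finsupp.degree_eq_sum]
  have hli : LinearIndependent ℂ fun d : {d : Fin (m + 1) →₀ ℕ | d.degree = k} =>
      monomial (d : Fin (m + 1) →₀ ℕ) (1 : ℂ) :=
    (basisMonomials (Fin (m + 1)) ℂ).linearIndependent.comp _ Subtype.val_injective
  have hspan : homogeneousSubmodule (Fin (m + 1)) ℂ k =
      Submodule.span ℂ (Set.range fun d : {d : Fin (m + 1) →₀ ℕ | d.degree = k} =>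
        monomial (d : Fin (m + 1) →₀ ℕ) (1 : ℂ)) := by
    refine le_antisymm (fun q hq => ?_) (Submodule.span_le.2 ?_)
    · rw [q.as_sum]
      refine Submodule.sum_mem _ fun d hd => ?_
      have hdd : d.degree = k := (((mem_homogeneousSubmodule _ _).1 hq).degree_eq_sum_deg_support
        hd).symm
      rw [← mul_one (coeff d q), ← smul_eq_mul, ← smul_monomial]
      exact Submodule.smul_mem _ _ (Submodule.subset_span ⟨⟨d, hdd⟩, rfl⟩)
    · rintro _ ⟨d, rfl⟩
      exact isHomogeneous_monomial 1 d.2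
  have hfin : Fintype {d : Fin (m + 1) →₀ ℕ | d.degree = k} := by
    rw [hset]
    infer_instance
  rw [hspan, finrank_span_eq_card hli, ← Nat.card_eq_fintype_card, hset,
    Nat.card_eq_fintype_card]
  simp only [Finset.coe_sort_coe, Fintype.card_coe]
  rw [Finset.card_finsuppAntidiag_nat_eq_choose, Finset.card_univ, Fintype.card_fin,
    show m + 1 + k - 1 = m + k by omega, Nat.choose_symm_add]

end HomogeneousDimension

section CoefficientIdeal

/-- The span of the products `c_j * r` with `r` homogeneous. -/
noncomputable def coeffSpan (a n k : ℕ) : Submodule ℂ (MvPolynomial (Fin (n + 1)) ℂ) :=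
  Submodule.span ℂ {q | ∃ j ≤ a * n, ∃ r : MvPolynomial (Fin (n + 1)) ℂ,
    r.IsHomogeneous k ∧ q = coeffC a n j * r}

theorem sum_sq_lt {a : ℕ} (κ : Fin a → ℕ) (i : ℕ) (hs : ∑ l, κ l = a * i) (hne : κ ≠ fun _ => i) :
    a * i ^ 2 < ∑ l, κ l ^ 2 := by
  obtain ⟨l₀, hl₀⟩ := Function.ne_iff.1 hne
  have hs' : ∑ l, (κ l : ℤ) = a * i := by exact_mod_cast hs
  have h : ∑ l, ((κ l : ℤ) - i) ^ 2 = ∑ l, (κ l : ℤ) ^ 2 - a * i ^ 2 := by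
    simp only [sub_sq, Finset.sum_add_distrib, Finset.sum_sub_distrib, mul_assoc, ← Finset.mul_sum,
      ← Finset.sum_mul, hs', Finset.sum_const, Finset.card_univ, Fintype.card_fin, nsmul_eq_mul]
    ring
  have hpos : 0 < ∑ l, ((κ l : ℤ) - i) ^ 2 :=
    Finset.sum_pos' (fun l _ => sq_nonneg _) ⟨l₀, Finset.mem_univ _,
      sq_pos_of_ne_zero (sub_ne_zero.2 (by exact_mod_cast hl₀))⟩
  zify
  linarith

theorem monomial_mem_coeffSpan (a n : ℕ) :
    ∀ (M : ℕ) (e : Fin (n + 1) →₀ ℕ), e.degree = a * (n + 1) →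
      a * (n + 1) * n ^ 2 - ∑ i, e i * (i : ℕ) ^ 2 ≤ M →
      monomial e (1 : ℂ) ∈ coeffSpan a n (a * n) := by
  intro M
  induction M using Nat.strong_induction_on with
  | _ M ih =>
  intro e he hM
  have hbound : ∀ e : Fin (n + 1) →₀ ℕ, e.degree = a * (n + 1) →
      ∑ i, e i * (i : ℕ) ^ 2 ≤ a * (n + 1) * n ^ 2 := by
    intro e he
    rw [← he, Finsupp.degree_eq_sum, Finset.sum_mul]
    refine Finset.sum_le_sum fun i _ => Nat.mul_le_mul_left _ (Nat.pow_le_pow_left ?_ _)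
    exact Nat.lt_succ_iff.1 i.2
  obtain ⟨i, hi⟩ : ∃ i, a ≤ e i := by
    by_contra! h
    have : ∑ i, e i < ∑ _i : Fin (n + 1), a :=
      Finset.sum_lt_sum_of_nonempty Finset.univ_nonempty fun i _ => h i
    rw [← Finsupp.degree_eq_sum, he, Finset.sum_const, Finset.card_univ, Fintype.card_fin,
      smul_eq_mul, mul_comm] at this
    exact lt_irrefl _ this
  have hin : (i : ℕ) ≤ n := Nat.lt_succ_iff.1 i.2
  obtain ⟨f, rfl⟩ : ∃ f, e = Finsupp.single i a + f :=
    ⟨e - Finsupp.single i a, (add_tsub_cancel_of_le (Finsupp.single_le_iff.2 hi)).symm⟩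
  have hf : f.degree = a * n := by
    rw [map_add, Finsupp.degree_single] at he
    linarith
  have hji : a * i ≤ a * n := Nat.mul_le_mul_left _ hin
  have hc := coeffC_eq_sum hji
  rw [← Finset.sum_erase_add _ _ (Finset.mem_univ (fun _ : Fin a => i))] at hc
  rw [if_pos (by simp), Finset.prod_const, Finset.card_univ, Fintype.card_fin] at hc
  have hmon : monomial (Finsupp.single i a + f) (1 : ℂ) = coeffC a n (a * i) * monomial f 1 -
      ∑ κ ∈ Finset.univ.erase (fun _ : Fin a => i),
        (if a * (i : ℕ) = ∑ l, (κ l : ℕ) then ∏ l, X (κ l) else 0) * monomial f 1 := by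
    rw [hc, ← Finset.sum_mul, ← sub_mul, add_sub_cancel_left, X_pow_eq_monomial, monomial_mul,
      one_mul]
  rw [hmon]
  refine Submodule.sub_mem _ (Submodule.subset_span
    ⟨a * i, hji, _, isHomogeneous_monomial 1 hf, rfl⟩) (Submodule.sum_mem _ fun κ hκ => ?_)
  split_ifs with h
  · have hprod : (∏ l, X (κ l) : MvPolynomial (Fin (n + 1)) ℂ) * monomial f 1 =
        monomial ((∑ l, Finsupp.single (κ l) 1) + f) 1 := by
      simp only [X, ← monomial_sum_one]
      rw [monomial_mul, one_mul]
    have hdeg : ((∑ l, Finsupp.single (κ l) 1) + f).degree = a * (n + 1) := by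
      rw [map_add, map_sum, hf]
      simp
      ring
    have hw : ∑ j, ((Finsupp.single i a + f : Fin (n + 1) →₀ ℕ) j) * (j : ℕ) ^ 2 <
        ∑ j, (((∑ l, Finsupp.single (κ l) 1) + f : Fin (n + 1) →₀ ℕ) j) * (j : ℕ) ^ 2 := by
      simp only [Finsupp.add_apply, add_mul, Finset.sum_add_distrib, Finsupp.finsetSum_apply,
        Finset.sum_mul]
      rw [Finset.sum_comm (f := fun j l => (Finsupp.single (κ l) 1 : Fin (n + 1) →₀ ℕ) j * (j : ℕ) ^ 2)]
      simp only [Finsupp.single_apply, ite_mul, zero_mul, one_mul, Finset.sum_ite_eq, Finset.mem_univ,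
        if_true]
      refine Nat.add_lt_add_right (sum_sq_lt (fun l => (κ l : ℕ)) i h.symm fun hk => ?_) _
      refine (Finset.mem_erase.1 hκ).1 (funext fun l => Fin.ext (congrFun hk l))
    rw [hprod]
    have h1 := hbound _ hdeg
    exact ih _ (by omega) _ hdeg le_rfl
  · rw [zero_mul]
    exact Submodule.zero_mem _

theorem mem_coeffSpan {a n : ℕ} {q : MvPolynomial (Fin (n + 1)) ℂ}
    (hq : q.IsHomogeneous (a * (n + 1))) : q ∈ coeffSpan a n (a * n) := by
  rw [q.as_sum]
  refine Submodule.sum_mem _ fun d hd => ?_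
  rw [← mul_one (coeff d q), ← smul_eq_mul (coeff d q), ← smul_monomial]
  exact Submodule.smul_mem _ _ (monomial_mem_coeffSpan a n _ d
    (hq.degree_eq_sum_deg_support hd).symm le_rfl)

theorem exists_FH_succ_eq {a n : ℕ}
    (hn : ∀ q : MvPolynomial (Fin (n + 1)) ℂ, q.IsHomogeneous (a * n) →
      ∃ P, P.IsHomogeneous n ∧ FH a n P = q)
    {q : MvPolynomial (Fin (n + 1)) ℂ} (hq : q.IsHomogeneous (a * (n + 1))) :
    ∃ P, P.IsHomogeneous (n + 1) ∧ FH a n P = q := by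
  have h : coeffSpan a n (a * n) ≤
      (homogeneousSubmodule (Fin (a * n + 1)) ℂ (n + 1)).map (FH a n).toLinearMap := by
    refine Submodule.span_le.2 ?_
    rintro _ ⟨j, hj, r, hr, rfl⟩
    obtain ⟨P, hP, rfl⟩ := hn r hr
    refine ⟨X ⟨j, Nat.lt_succ_of_le hj⟩ * P, ?_, ?_⟩
    · have := (isHomogeneous_X ℂ (⟨j, Nat.lt_succ_of_le hj⟩ : Fin (a * n + 1))).mul hP
      rwa [add_comm 1 n] at this
    · simp [FH]
  obtain ⟨P, hP, hPq⟩ := h (mem_coeffSpan hq)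
  exact ⟨P, hP, hPq⟩

end CoefficientIdeal

section LinearAlgebra

variable {K V W U : Type*} [Field K] [AddCommGroup V] [Module K V] [AddCommGroup W] [Module K W]
  [AddCommGroup U] [Module K U]

theorem finrank_range_le_of_ker_le (f : V →ₗ[K] W) (g : V →ₗ[K] U)
    (h : LinearMap.ker f ≤ LinearMap.ker g) [FiniteDimensional K (LinearMap.range f)] :
    Module.finrank K (LinearMap.range g) ≤ Module.finrank K (LinearMap.range f) := by
  have hr : LinearMap.range g =
      LinearMap.range ((LinearMap.ker f).liftQ g h ∘ₗ f.quotKerEquivRange.symm.toLinearMap) := by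
    rw [LinearMap.range_comp_of_range_eq_top _ (LinearEquiv.range _), Submodule.range_liftQ]
  rw [hr]
  exact LinearMap.finrank_range_le _

theorem succ_mul_finrank_le [FiniteDimensional K V] (N : Module.End K V) (Q : Submodule K V)
    (k : ℕ) (hN : ∀ q ∈ Q, N q = 0) (hQ : Q ≤ LinearMap.range (N ^ k)) :
    (k + 1) * Module.finrank K Q ≤ Module.finrank K V := by
  have h : ∀ i ≤ k, (i + 1) * Module.finrank K Q ≤ Module.finrank K (Q.comap (N ^ i)) := by
    intro i
    induction i with
    | zero =>
      intro _
      rw [pow_zero, Module.End.one_eq_id, Submodule.comap_id, zero_add, one_mul]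
    | succ i ih =>
      intro hi
      set U := Q.comap (N ^ (i + 1)) with hU
      set g := (N ^ (i + 1)).domRestrict U with hg
      have hrange : Q ≤ LinearMap.range g := by
        intro q hq
        obtain ⟨w, hw⟩ := hQ hq
        have hw' : (N ^ (i + 1)) ((N ^ (k - (i + 1))) w) = q := by
          rw [← Module.End.mul_apply, ← pow_add, Nat.add_sub_cancel' hi, hw]
        refine ⟨⟨(N ^ (k - (i + 1))) w, ?_⟩, hw'⟩
        rw [hU, Submodule.mem_comap, hw']
        exact hq
      have hker : Q.comap (N ^ i) ≤ (LinearMap.ker g).map U.subtype := by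
        intro w hw
        have h0 : (N ^ (i + 1)) w = 0 := by
          rw [pow_succ', Module.End.mul_apply]
          exact hN _ hw
        have hwU : w ∈ U := by
          rw [hU, Submodule.mem_comap, h0]
          exact Q.zero_mem
        exact ⟨⟨w, hwU⟩, h0, rfl⟩
      have h1 := Submodule.finrank_mono hrange
      have h2 := Submodule.finrank_mono hker
      rw [Submodule.finrank_map_subtype_eq] at h2
      have h3 := g.finrank_range_add_finrank_ker
      have h4 := ih (by omega)
      linarith
  exact (h k le_rfl).trans (Submodule.finrank_le _)

theorem finrank_eq_of_dualCoannihilator_eq_bot [FiniteDimensional K V]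
    {E : Submodule K (Module.Dual K V)} (h : E.dualCoannihilator = ⊥) :
    Module.finrank K E = Module.finrank K V := by
  have h1 := Subspace.finrank_add_finrank_dualCoannihilator_eq E
  rwa [h, finrank_bot, add_zero] at h1

theorem finrank_le_of_separating_aux [FiniteDimensional K V] (f : U →ₗ[K] W)
    (g : U →ₗ[K] Module.Dual K V) (Q : Submodule K W) [FiniteDimensional K Q]
    (hQ : ∀ φ, f φ ∈ Q) (hker : ∀ φ, f φ = 0 → g φ = 0)
    (hsep : ∀ p, (∀ φ, g φ p = 0) → p = 0) :
    Module.finrank K V ≤ Module.finrank K Q := by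
  have hfQ : LinearMap.range f ≤ Q := by
    rintro _ ⟨φ, rfl⟩
    exact hQ φ
  have := Submodule.finiteDimensional_of_le hfQ
  have hg : (LinearMap.range g).dualCoannihilator = ⊥ := by
    rw [eq_bot_iff]
    intro p hp
    rw [Submodule.mem_dualCoannihilator] at hp
    exact hsep p fun φ => hp (g φ) ⟨φ, rfl⟩
  have h2 := finrank_range_le_of_ker_le f g hker
  rw [finrank_eq_of_dualCoannihilator_eq_bot hg] at h2
  exact h2.trans (Submodule.finrank_mono hfQ)

theorem finrank_le_of_separating {D : Submodule K V} [FiniteDimensional K D]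
    (Φ : Submodule K (Module.Dual K V)) (f : Module.Dual K V →ₗ[K] W) (Q : Submodule K W)
    [FiniteDimensional K Q] (hQ : ∀ φ ∈ Φ, f φ ∈ Q)
    (hker : ∀ φ, f φ = 0 → ∀ p ∈ D, φ p = 0)
    (hsep : ∀ p ∈ D, (∀ φ ∈ Φ, φ p = 0) → p = 0) :
    Module.finrank K D ≤ Module.finrank K Q :=
  finrank_le_of_separating_aux (U := Φ) (V := D) (f.domRestrict Φ) (D.dualRestrict.domRestrict Φ) Q
    (fun φ => hQ _ φ.2) (fun φ hφ => LinearMap.ext fun p => hker φ hφ p p.2)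
    fun p hp => Subtype.ext (hsep p p.2 fun φ hφ => hp ⟨φ, hφ⟩)

end LinearAlgebra

section KernelDual

theorem kernelX_eq_smul_kernelY (a n b : ℕ) (y : Fin b → ℂ) :
    kernelX a n b y = (-1 : ℂ) ^ (n * b * a) • kernelY a b n y := by
  simp only [kernelX, kernelY]
  rw [Finset.prod_comm]
  have h : ∀ (j : Fin b) (i : Fin n), (X i - C (y j) : MvPolynomial (Fin n) ℂ) ^ a =
      C ((-1) ^ a) * (C (y j) - X i) ^ a := fun j i => by
    rw [← neg_sub, neg_pow]
    simp
  simp only [h, Finset.prod_mul_distrib, Finset.prod_const, Finset.card_univ, Fintype.card_fin,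
    smul_eq_C_mul, ← C_pow, ← pow_mul]
  congr 3
  ring

theorem apply_prod_rootCoeff_eq_zero {a n b : ℕ} {φ : Module.Dual ℂ (MvPolynomial (Fin n) ℂ)}
    (h : kernelMap a n b φ = 0) (κ : Fin b → Fin (a * n + 1)) :
    φ (∏ j, rootCoeff a n (κ j)) = 0 := by
  have hz : ∑ κ : Fin b → Fin (a * n + 1), monomial
      (Finsupp.equivFunOnFinite.symm fun j => (κ j : ℕ)) (φ (∏ j, rootCoeff a n (κ j))) = 0 := by
    apply MvPolynomial.funext
    intro y
    have hy := eval_kernelMap a n b φ y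
    rw [h, map_zero, kernelX_eq_smul_kernelY, map_smul φ, kernelY_eq_sum, map_sum, eq_comm,
      smul_eq_zero_iff_right (pow_ne_zero _ (by norm_num))] at hy
    rw [map_sum, map_zero, ← hy]
    refine Finset.sum_congr rfl fun κ _ => ?_
    rw [map_smul φ, eval_monomial, Finsupp.prod_fintype _ _ fun _ => pow_zero _, smul_eq_mul,
      mul_comm]
    rfl
  have hc := congrArg (coeff (Finsupp.equivFunOnFinite.symm fun j => (κ j : ℕ))) hz
  rw [coeff_sum, coeff_zero, Finset.sum_eq_single κ] at hc
  · rwa [coeff_monomial, if_pos rfl] at hc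
  · intro κ' _ hne
    rw [coeff_monomial, if_neg]
    intro he
    exact hne (funext fun j => Fin.ext (congrFun (Finsupp.equivFunOnFinite.symm.injective he) j))
  · intro hκ
    exact absurd (Finset.mem_univ _) hκ

theorem exists_prod_X_eq {σ : Type*} (d : σ →₀ ℕ) {k : ℕ} (hd : d.degree = k) :
    ∃ κ : Fin k → σ, monomial d (1 : ℂ) = ∏ l, X (κ l) := by
  induction k generalizing d with
  | zero =>
    rw [Finsupp.degree_eq_zero_iff] at hd
    exact ⟨Fin.elim0, by simp [hd]⟩
  | succ k ih =>
    obtain ⟨i, hi⟩ : ∃ i, d i ≠ 0 := by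
      by_contra! h
      rw [(Finsupp.ext h : d = 0), map_zero] at hd
      omega
    obtain ⟨f, rfl⟩ : ∃ f, d = Finsupp.single i 1 + f :=
      ⟨d - Finsupp.single i 1, (add_tsub_cancel_of_le
        (Finsupp.single_le_iff.2 (Nat.one_le_iff_ne_zero.2 hi))).symm⟩
    rw [map_add, Finsupp.degree_single] at hd
    obtain ⟨κ, hκ⟩ := ih f (by omega)
    refine ⟨Fin.cons i κ, ?_⟩
    rw [Fin.prod_univ_succ, Fin.cons_zero]
    simp only [Fin.cons_succ]
    rw [← hκ, X, monomial_mul, one_mul]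

theorem rootEval_FH_monomial {a n k : ℕ} (κ : Fin k → Fin (a * n + 1)) :
    rootEval n (FH a n (∏ l, X (κ l))) = ∏ l, rootCoeff a n (κ l) := by
  rw [FH, map_prod, map_prod]
  refine Finset.prod_congr rfl fun l _ => ?_
  rw [aeval_X, rootEval_coeffC (Nat.lt_succ_iff.1 (κ l).2)]

theorem apply_rootEval_FH_eq_zero {a n b : ℕ} {φ : Module.Dual ℂ (MvPolynomial (Fin n) ℂ)}
    (h : kernelMap a n b φ = 0) {P : MvPolynomial (Fin (a * n + 1)) ℂ} (hP : P.IsHomogeneous b) :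
    φ (rootEval n (FH a n P)) = 0 := by
  rw [P.as_sum, map_sum, map_sum, map_sum]
  refine Finset.sum_eq_zero fun d hd => ?_
  obtain ⟨κ, hκ⟩ := exists_prod_X_eq d (hP.degree_eq_sum_deg_support hd).symm
  rw [← mul_one (coeff d P), ← smul_eq_mul (coeff d P), ← smul_monomial, map_smul, map_smul,
    map_smul, hκ, rootEval_FH_monomial, apply_prod_rootCoeff_eq_zero h, smul_zero]

theorem range_kernelMap_le (a n b : ℕ) : LinearMap.range (kernelMap a n b) ≤
    (homogeneousSubmodule (Fin (a * b + 1)) ℂ n).map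
      ((rootEval b).toLinearMap ∘ₗ (FH a b).toLinearMap) := by
  rintro _ ⟨φ, rfl⟩
  rw [kernelMap_apply]
  refine Submodule.sum_mem _ fun κ _ => Submodule.smul_mem _ _ ⟨∏ l, X (κ l), ?_, ?_⟩
  · simpa using IsHomogeneous.prod Finset.univ
      (fun l => (X (κ l) : MvPolynomial (Fin (a * b + 1)) ℂ)) (fun _ => 1)
      fun l _ => isHomogeneous_X ℂ (κ l)
  · exact rootEval_FH_monomial κ

theorem kernelMap_evalZero (a n b : ℕ) :
    kernelMap a n b (aeval (0 : Fin n → ℂ)).toLinearMap =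
      (-1 : ℂ) ^ (n * b * a) • (∏ j, X j) ^ (a * n) := by
  apply MvPolynomial.funext
  intro y
  rw [eval_kernelMap]
  change eval (0 : Fin n → ℂ) (kernelX a n b y) = _
  rw [eval_kernelX, smul_eval]
  simp only [Pi.zero_apply, zero_sub, neg_pow (y _), Finset.prod_mul_distrib, Finset.prod_const,
    Finset.card_univ, Fintype.card_fin, map_pow, map_prod, eval_X, ← pow_mul, Finset.prod_pow]
  congr 2
  ring

end KernelDual

section Surjectivity

instance (m k : ℕ) : FiniteDimensional ℂ (homogeneousSubmodule (Fin m) ℂ k) :=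
  Module.Finite.iff_fg.2 (homogeneousSubmodule_fg (σ := Fin m) (R := ℂ) k)

/-- The cyclic module generated by `(∏ j, X j)^m` under the operators of the Dunkl algebra. -/
noncomputable def cyclicModule (c : ℂ) (b m : ℕ) : Submodule ℂ (MvPolynomial (Fin b) ℂ) :=
  (Subalgebra.toSubmodule (dunklAlg (Fin b) c)).map
    (LinearMap.applyₗ ((∏ j, X j : MvPolynomial (Fin b) ℂ) ^ m))

theorem mem_cyclicModule {c : ℂ} {b m : ℕ} {p : MvPolynomial (Fin b) ℂ} :
    p ∈ cyclicModule c b m ↔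
      ∃ x ∈ dunklAlg (Fin b) c, x ((∏ j, X j : MvPolynomial (Fin b) ℂ) ^ m) = p :=
  Iff.rfl

theorem apply_mem_cyclicModule {c : ℂ} {b m : ℕ} {x : Module.End ℂ (MvPolynomial (Fin b) ℂ)}
    (hx : x ∈ dunklAlg (Fin b) c) : ∀ p ∈ cyclicModule c b m, x p ∈ cyclicModule c b m := by
  rintro _ ⟨y, hy, rfl⟩
  exact mem_cyclicModule.2 ⟨x * y, mul_mem hx hy, rfl⟩

theorem dunklN_prod_pow_mul_eq_zero (a n : ℕ) :
    dunklN (a : ℂ) ((∏ j : Fin (n + 1), X j) ^ (a * n)) = 0 := by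
  rcases Nat.eq_zero_or_eq_succ_pred (a * n) with h | h
  · rw [h, pow_zero, dunklN, Fin.prod_univ_castSucc, map_mul (dunklPoly (a : ℂ)),
      Module.End.mul_apply, dunklPoly_X, ← C_1, dunkl_C, map_zero]
  · rw [h, dunklN_prod_pow, Finset.prod_eq_zero (i := n), zero_smul]
    · simp
    · have : (((a * n).pred + 1 : ℕ) : ℂ) = a * n := by
        rw [← Nat.succ_eq_add_one, ← h]
        push_cast
        rfl
      rw [← this]
      push_cast
      ring

theorem dunklN_eq_zero_of_mem_cyclicModule {a n : ℕ} {p : MvPolynomial (Fin (n + 1)) ℂ}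
    (hp : p ∈ cyclicModule (a : ℂ) (n + 1) (a * n)) : dunklN (a : ℂ) p = 0 := by
  obtain ⟨x, hx, rfl⟩ := mem_cyclicModule.1 hp
  obtain ⟨y, hy⟩ := exists_dunklN_mul_eq (a : ℂ) hx
  rw [← Module.End.mul_apply, hy, Module.End.mul_apply, dunklN_prod_pow_mul_eq_zero, map_zero]

theorem exists_dunklN_pow_prod_pow_eq (a n k : ℕ) : ∃ r : ℂ, r ≠ 0 ∧
    (dunklN (a : ℂ) ^ k) ((∏ j : Fin (n + 1), X j) ^ (a * n + k)) =
      r • (∏ j : Fin (n + 1), X j) ^ (a * n) := by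
  induction k with
  | zero => exact ⟨1, one_ne_zero, by simp⟩
  | succ k ih =>
    obtain ⟨r, hr, h⟩ := ih
    refine ⟨(∏ i ∈ Finset.range (n + 1), (((a * n + k : ℕ) : ℂ) + 1 - a * i)) * r,
      mul_ne_zero (Finset.prod_ne_zero_iff.2 fun i hi h0 => ?_) hr, ?_⟩
    · have hle : a * i ≤ a * n := Nat.mul_le_mul_left _ (by simpa [Nat.lt_succ_iff] using hi)
      rw [sub_eq_zero] at h0
      have : a * n + k + 1 = a * i := by exact_mod_cast h0
      omega
    · rw [pow_succ, Module.End.mul_apply, ← add_assoc, dunklN_prod_pow, Fintype.card_fin, map_smul,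
        h, smul_smul]

theorem prod_pow_mem_range_kernelMap (a b : ℕ) :
    (∏ j : Fin b, X j) ^ (a * b) ∈ LinearMap.range (kernelMap a b b) := by
  have h : (-1 : ℂ) ^ (b * b * a) • (∏ j : Fin b, X j) ^ (a * b) ∈
      LinearMap.range (kernelMap a b b) := ⟨_, kernelMap_evalZero a b b⟩
  rwa [Submodule.smul_mem_iff _ (pow_ne_zero _ (by norm_num))] at h

theorem exists_dunklN_pow_eq_of_mem_cyclicModule {a n : ℕ} {p : MvPolynomial (Fin (n + 1)) ℂ}
    (hp : p ∈ cyclicModule (a : ℂ) (n + 1) (a * n)) :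
    ∃ w ∈ LinearMap.range (kernelMap a (n + 1) (n + 1)), (dunklN (a : ℂ) ^ a) w = p := by
  obtain ⟨x, hx, rfl⟩ := mem_cyclicModule.1 hp
  obtain ⟨y, hy, hxy⟩ := exists_mul_dunklN_pow_eq (a : ℂ) a hx
  obtain ⟨r, hr, h⟩ := exists_dunklN_pow_prod_pow_eq a n a
  refine ⟨r⁻¹ • y ((∏ j : Fin (n + 1), X j) ^ (a * n + a)), Submodule.smul_mem _ _
    (mem_range_kernelMap hy _ (prod_pow_mem_range_kernelMap a (n + 1))), ?_⟩
  rw [map_smul, ← Module.End.mul_apply, ← hxy, Module.End.mul_apply, h, map_smul, smul_smul,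
    inv_mul_cancel₀ hr, one_smul]

instance (a n b : ℕ) : FiniteDimensional ℂ (LinearMap.range (kernelMap a n b)) :=
  Submodule.finiteDimensional_of_le (range_kernelMap_le a n b)

theorem dunklN_pow_mem_range {a b n : ℕ} (k : ℕ) : ∀ p ∈ LinearMap.range (kernelMap a n b),
    (dunklN (a : ℂ) ^ k) p ∈ LinearMap.range (kernelMap a n b) :=
  mem_range_kernelMap (pow_mem (dunklN_mem _) k)

theorem cyclicModule_le_range_kernelMap (a n : ℕ) : cyclicModule (a : ℂ) (n + 1) (a * n) ≤
    LinearMap.range (kernelMap a (n + 1) (n + 1)) := by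
  intro p hp
  obtain ⟨w, hw, rfl⟩ := exists_dunklN_pow_eq_of_mem_cyclicModule hp
  exact dunklN_pow_mem_range a w hw

theorem succ_mul_finrank_cyclicModule_le (a n : ℕ) :
    (a + 1) * Module.finrank ℂ (cyclicModule (a : ℂ) (n + 1) (a * n)) ≤
      Module.finrank ℂ (LinearMap.range (kernelMap a (n + 1) (n + 1))) := by
  set W := LinearMap.range (kernelMap a (n + 1) (n + 1)) with hW
  have hN : ∀ p ∈ W, dunklN (a : ℂ) p ∈ W := mem_range_kernelMap (dunklN_mem _)
  have h := succ_mul_finrank_le ((dunklN (a : ℂ)).restrict hN)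
    ((cyclicModule (a : ℂ) (n + 1) (a * n)).comap W.subtype) a
    (fun q hq => Subtype.ext (dunklN_eq_zero_of_mem_cyclicModule hq)) (fun q hq => by
      obtain ⟨w, hw, h⟩ := exists_dunklN_pow_eq_of_mem_cyclicModule hq
      refine ⟨⟨w, hw⟩, Subtype.ext ?_⟩
      rw [Module.End.pow_restrict]
      exact h)
  rwa [(Submodule.comapSubtypeEquivOfLe (cyclicModule_le_range_kernelMap a n)).finrank_eq] at h

theorem finrank_map_rootEval (n k : ℕ) :
    Module.finrank ℂ ((homogeneousSubmodule (Fin (n + 1)) ℂ k).map (rootEval n).toLinearMap) =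
      (n + k).choose n := by
  rw [← LinearMap.range_domRestrict, LinearMap.finrank_range_of_inj, finrank_homogeneousSubmodule]
  rw [← LinearMap.ker_eq_bot, eq_bot_iff]
  intro q hq
  exact Subtype.ext (eq_zero_of_rootEval_eq_zero q.2 hq)

theorem choose_le_finrank_cyclicModule {a n : ℕ}
    (hn : ∀ q : MvPolynomial (Fin (n + 1)) ℂ, q.IsHomogeneous (a * n) →
      ∃ P, P.IsHomogeneous n ∧ FH a n P = q) :
    (n + a * (n + 1)).choose n ≤
      Module.finrank ℂ (cyclicModule (a : ℂ) (n + 1) (a * n)) := by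
  rw [← finrank_map_rootEval]
  have := Submodule.finiteDimensional_of_le (cyclicModule_le_range_kernelMap a n)
  refine finrank_le_of_separating
    ((cyclicModule (a : ℂ) (n + 1) (a * n)).comap (kernelMap a n (n + 1))) (kernelMap a n (n + 1))
    _ (fun φ hφ => hφ) ?_ ?_
  · rintro φ hφ _ ⟨q, hq, rfl⟩
    obtain ⟨P, hP, rfl⟩ := exists_FH_succ_eq hn hq
    exact apply_rootEval_FH_eq_zero hφ hP
  · rintro _ ⟨q, hq, rfl⟩ h
    by_contra h0
    obtain ⟨x, hx, hne⟩ := exists_eval_dunklAlg_ne_zero a (rootEval_isSymmetric n q) h0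
    refine hne (h ((aeval (0 : Fin n → ℂ)).toLinearMap ∘ₗ x) (kernelMap_comp_mem
      (fun y hy => apply_mem_cyclicModule hy) hx _ ?_))
    rw [kernelMap_evalZero]
    exact Submodule.smul_mem _ _ (mem_cyclicModule.2 ⟨1, one_mem _, rfl⟩)

theorem choose_mul_succ_eq (a n : ℕ) :
    (n + 1 + a * (n + 1)).choose (n + 1) = (a + 1) * (n + a * (n + 1)).choose n := by
  have h := Nat.add_one_mul_choose_eq (n + a * (n + 1)) n
  refine Nat.eq_of_mul_eq_mul_right (Nat.succ_pos n) ?_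
  rw [show n + 1 + a * (n + 1) = n + a * (n + 1) + 1 by ring, Nat.succ_eq_add_one, ← h]
  ring

theorem choose_le_finrank_map_FH {a n : ℕ}
    (hn : ∀ q : MvPolynomial (Fin (n + 1)) ℂ, q.IsHomogeneous (a * n) →
      ∃ P, P.IsHomogeneous n ∧ FH a n P = q) :
    (n + 1 + a * (n + 1)).choose (n + 1) ≤ Module.finrank ℂ
      ((homogeneousSubmodule (Fin (a * (n + 1) + 1)) ℂ (n + 1)).map
        (FH a (n + 1)).toLinearMap) := by
  rw [choose_mul_succ_eq]
  refine (Nat.mul_le_mul_left _ (choose_le_finrank_cyclicModule hn)).trans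
    ((succ_mul_finrank_cyclicModule_le a n).trans
      ((Submodule.finrank_mono (range_kernelMap_le a (n + 1) (n + 1))).trans ?_))
  rw [Submodule.map_comp]
  exact Submodule.finrank_map_le _ _

theorem map_FH_le (a b k : ℕ) : (homogeneousSubmodule (Fin (a * b + 1)) ℂ k).map
    (FH a b).toLinearMap ≤ homogeneousSubmodule (Fin (b + 1)) ℂ (a * k) := by
  rintro _ ⟨P, hP, rfl⟩
  exact isHomogeneous_FH hP

theorem map_FH_eq (a b : ℕ) : (homogeneousSubmodule (Fin (a * b + 1)) ℂ b).map
    (FH a b).toLinearMap = homogeneousSubmodule (Fin (b + 1)) ℂ (a * b) := by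
  induction b with
  | zero =>
    refine le_antisymm (map_FH_le a 0 0) fun q hq => ?_
    rw [mul_zero, homogeneousSubmodule_zero, Submodule.mem_one] at hq
    obtain ⟨r, rfl⟩ := hq
    refine ⟨C r, isHomogeneous_C _ r, ?_⟩
    simp [FH]
  | succ n ih =>
    refine Submodule.eq_of_le_of_finrank_le (map_FH_le a (n + 1) (n + 1)) ?_
    rw [finrank_homogeneousSubmodule]
    refine choose_le_finrank_map_FH fun q hq => ?_
    obtain ⟨P, hP, h⟩ := ih.ge hq
    exact ⟨P, hP, h⟩

end Surjectivity

/-- The Foulkes–Howe map restricts to a `ℂ`-linear isomorphism from the degree-`b`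
homogeneous component of `S` to the degree-`ab` homogeneous component of `R`:
every homogeneous `Q` of degree `ab` has a unique homogeneous preimage of degree `b`. -/
theorem foulkesHowe_degree_b_bijective (a b : ℕ) (ha : 1 ≤ a) (hb : 1 ≤ b)
    (Q : MvPolynomial (Fin (b + 1)) ℂ) (hQ : Q.IsHomogeneous (a * b)) :
    ∃! P : MvPolynomial (Fin (a * b + 1)) ℂ, P.IsHomogeneous b ∧ FH a b P = Q := by
  obtain ⟨P, hP, hPQ⟩ := (map_FH_eq a b).ge hQ
  refine ⟨P, ⟨hP, hPQ⟩, fun P' ⟨hP', hPQ'⟩ => ?_⟩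
  have h := ((FH a b).toLinearMap.domRestrict
    (homogeneousSubmodule (Fin (a * b + 1)) ℂ b)).finrank_range_add_finrank_ker
  rw [LinearMap.range_domRestrict, map_FH_eq, finrank_homogeneousSubmodule,
    finrank_homogeneousSubmodule, add_comm (a * b) b, Nat.choose_symm_add, Nat.add_eq_left,
    Submodule.finrank_eq_zero, LinearMap.ker_eq_bot] at h
  exact congrArg Subtype.val (@h ⟨P', hP'⟩ ⟨P, hP⟩ (hPQ'.trans hPQ.symm))
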